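/- arXiv:1305.0177 — 2 statements merged into one kernel-verified Lean document; each statement's English description precedes it below -/
import Mathlib

section
/- There exist a constant k_0 ∈ ℕ and a function ε: ℕ → ℝ with ε_k → 0 as k → ∞ such that for every integer k ≥ k_0 and every real d with d ≥ 2k·ln k − ln k − 1 + ε_k, the probability that the random graph G(n,⌈dn/2⌉) admits a k-coloring tends to 0 as n → ∞. -/
open Filter

/-- Uniform counting probability on a finite sample space `Ω`:
the fraction of elements satisfying `p`. -/
noncomputable def prob {Ω : Type*} (p : Ω → Prop) : ℝ :=
  (Nat.card {x : Ω // p x} : ℝ) / (Nat.card Ω : ℝ)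

/-- The sample space of the random graph `G(n,m)`: simple graphs on `Fin n`
with exactly `m` edges, encoded as sets of non-diagonal unordered pairs. -/
def GraphSpace (n m : ℕ) : Type :=
  {E : Finset (Sym2 (Fin n)) // E.card = m ∧ ∀ e ∈ E, ¬ e.IsDiag}

/-- `σ` is a proper `k`-coloring of the graph with edge set `E`. -/
def IsColoring {n k : ℕ} (E : Finset (Sym2 (Fin n))) (σ : Fin n → Fin k) : Prop :=
  ∀ u v : Fin n, s(u, v) ∈ E → σ u ≠ σ v

/-- Twice the sum over ordered pairs completes the square of the sum. -/
theorem two_mul_sum_sum_Ioi_mul {k : ℕ} (f : Fin k → ℝ) :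
    2 * ∑ i, ∑ j ∈ Finset.Ioi i, f i * f j = (∑ i, f i) ^ 2 - ∑ i, f i ^ 2 := by
  have hswap : ∑ i, ∑ j ∈ Finset.Ioi i, f i * f j = ∑ i, ∑ j ∈ Finset.Iio i, f i * f j := by
    rw [Finset.sum_comm' (t' := Finset.univ) (s' := fun j => Finset.Iio j) (by simp)]
    simp only [mul_comm]
  have hsplit : ∀ i : Fin k, ∑ j, f i * f j
      = ∑ j ∈ Finset.Iio i, f i * f j + f i ^ 2 + ∑ j ∈ Finset.Ioi i, f i * f j := by
    intro i
    have h1 : (Finset.univ : Finset (Fin k)) = (Finset.Iio i ∪ {i}) ∪ Finset.Ioi i := by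
      ext j; simp; omega
    rw [h1, Finset.sum_union, Finset.sum_union, Finset.sum_singleton, sq]
    · simp
    · rw [Finset.disjoint_left]; intro j; simp
  rw [sq, Finset.sum_mul_sum, Finset.sum_congr rfl (fun i _ => hsplit i),
    Finset.sum_add_distrib, Finset.sum_add_distrib, ← hswap]
  ring

theorem sum_sum_Ioi_right {k : ℕ} (f : Fin k → ℝ) :
    ∑ i, ∑ j ∈ Finset.Ioi i, f j = ∑ j : Fin k, (j : ℝ) * f j := by
  rw [Finset.sum_comm' (t' := Finset.univ) (s' := fun j => Finset.Iio j) (by simp)]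
  simp

theorem sum_sum_Ioi_left {k : ℕ} (f : Fin k → ℝ) :
    ∑ i, ∑ _j ∈ Finset.Ioi i, f i = (k - 1) * ∑ i, f i - ∑ j : Fin k, (j : ℝ) * f j := by
  rw [Finset.mul_sum, ← Finset.sum_sub_distrib]
  refine Finset.sum_congr rfl fun i _ => ?_
  have hi : ((k - 1 - (i : ℕ) : ℕ) : ℝ) = k - 1 - (i : ℕ) := by
    have := i.2
    rw [Nat.cast_sub (by omega), Nat.cast_sub (by omega)]; simp
  simp only [Finset.sum_const, Fin.card_Ioi, nsmul_eq_mul, hi]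
  ring

theorem sum_sum_Ioi_one (k : ℕ) :
    ∑ i : Fin k, ∑ _j ∈ Finset.Ioi i, (1 : ℝ) = k * (k - 1) / 2 := by
  have h1 := sum_sum_Ioi_left (k := k) (fun _ => 1)
  have h2 := sum_sum_Ioi_right (k := k) (fun _ => 1)
  simp only [Finset.sum_const, Finset.card_univ, Fintype.card_fin, nsmul_eq_mul, mul_one] at h1 h2 ⊢
  linarith

theorem log_one_sub_le {y : ℝ} (h0 : 0 ≤ y) (h1 : y < 1) :
    Real.log (1 - y) ≤ -(y + y ^ 2 / 2) := by
  have h := Real.hasSum_pow_div_log_of_abs_lt_one (x := y) (by rwa [abs_of_nonneg h0])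
  have := sum_le_hasSum (Finset.range 2) (fun i _ => by positivity) h
  norm_num [Finset.sum_range_succ] at this
  linarith

/-- The Gaussian part of the exponent is maximal at the balanced profile. -/
theorem pair_sum_eq {k : ℕ} (hk : 3 ≤ k) (a : ℝ) (ρ : Fin k → ℝ) (hρ : ∑ i, ρ i = 1) :
    ∑ i, ρ i * ∑ j ∈ Finset.Ioi i, 2 * a * k / (k - 1) * ρ j
      = a - a / (k * (k - 1)) * ∑ i, (k * ρ i - 1) ^ 2 := by
  have hk' : (3 : ℝ) ≤ k := by exact_mod_cast hk
  have h1 := two_mul_sum_sum_Ioi_mul ρ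
  have h2 : ∑ i, ρ i * ∑ j ∈ Finset.Ioi i, 2 * a * k / (k - 1) * ρ j
      = 2 * a * k / (k - 1) * ∑ i, ∑ j ∈ Finset.Ioi i, ρ i * ρ j := by
    simp only [Finset.mul_sum]
    exact Finset.sum_congr rfl fun i _ => Finset.sum_congr rfl fun j _ => by ring
  have h3 : ∑ i, ((k : ℝ) * ρ i - 1) ^ 2 = k ^ 2 * ∑ i, ρ i ^ 2 - k := by
    have : ∀ i, ((k : ℝ) * ρ i - 1) ^ 2 = k ^ 2 * ρ i ^ 2 - 2 * k * ρ i + 1 := fun i => by ring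
    simp only [this, Finset.sum_add_distrib, Finset.sum_sub_distrib, ← Finset.mul_sum, hρ]
    simp; ring
  rw [h2, h3]
  have h4 : ∑ i, ∑ j ∈ Finset.Ioi i, ρ i * ρ j = (1 - ∑ i, ρ i ^ 2) / 2 := by
    rw [hρ] at h1; linarith
  rw [h4]
  have : (k : ℝ) - 1 ≠ 0 := by linarith
  have : (k : ℝ) ≠ 0 := by linarith
  field_simp
  ring

/-- Lower bound for the weight of the rigidity constraints via the tangent line of `exp`. -/
theorem rigid_sum_ge {k : ℕ} (hk : 3 ≤ k) {α β : ℝ} (hβ : 0 ≤ β) (hα : α ≤ k * β)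
    (ρ : Fin k → ℝ) (hρ0 : ∀ i, 0 ≤ ρ i) (hρ : ∑ i, ρ i = 1) :
    Real.exp (-β) * ((k - 1) / 2 - (1 + β) / k * ∑ j : Fin k, (j : ℝ) * (k * ρ j - 1))
      ≤ ∑ i, ρ i * ∑ j ∈ Finset.Ioi i, Real.exp (-(α * ρ j)) := by
  have hk' : (3 : ℝ) ≤ k := by exact_mod_cast hk
  have hk0 : (k : ℝ) ≠ 0 := by linarith
  obtain ⟨x, hx⟩ : ∃ x : Fin k → ℝ, ∀ j, k * ρ j - 1 = x j := ⟨_, fun _ => rfl⟩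
  have hρx : ∀ j, ρ j = (1 + x j) / k := fun j => by rw [← hx]; field_simp; ring
  have hsx : ∑ j, x j = 0 := by
    simp only [← hx, Finset.sum_sub_distrib, ← Finset.mul_sum, hρ]; simp
  have hexp : ∀ j, Real.exp (-β) * (1 - β * x j) ≤ Real.exp (-(α * ρ j)) := by
    intro j
    have h1 : α * ρ j ≤ β + β * x j := by
      calc α * ρ j ≤ k * β * ρ j := mul_le_mul_of_nonneg_right hα (hρ0 j)
        _ = β + β * x j := by rw [← hx]; ring
    calc Real.exp (-β) * (1 - β * x j) ≤ Real.exp (-β) * Real.exp (-(β * x j)) := by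
          gcongr; linarith [Real.add_one_le_exp (-(β * x j))]
      _ = Real.exp (-(β + β * x j)) := by rw [← Real.exp_add]; ring_nf
      _ ≤ _ := by gcongr
  have hq := two_mul_sum_sum_Ioi_mul x
  rw [hsx] at hq
  have hsq : 0 ≤ ∑ i, x i ^ 2 := Finset.sum_nonneg fun i _ => sq_nonneg _
  have hl := sum_sum_Ioi_left x
  rw [hsx] at hl
  have hr := sum_sum_Ioi_right x
  have h1 := sum_sum_Ioi_one k
  calc Real.exp (-β) * ((k - 1) / 2 - (1 + β) / k * ∑ j : Fin k, (j : ℝ) * (k * ρ j - 1))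
      ≤ Real.exp (-β) * (1 / k * ∑ i, ∑ j ∈ Finset.Ioi i, (1 + x i) * (1 - β * x j)) := by
        gcongr
        have e : ∀ i j, (1 + x i) * (1 - β * x j)
            = 1 + x i - β * x j - β * (x i * x j) := fun i j => by ring
        simp only [e, Finset.sum_sub_distrib, Finset.sum_add_distrib, ← Finset.mul_sum, h1, hl, hr,
          hx]
        have : 0 ≤ -(β * ∑ i, ∑ j ∈ Finset.Ioi i, x i * x j) := by nlinarith
        simp only [← Finset.mul_sum] at this ⊢
        rw [div_mul_eq_mul_div, one_div, ← div_eq_inv_mul,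
          sub_le_iff_le_add, ← add_div, le_div_iff₀ (by linarith)]
        linarith
    _ = ∑ i, ρ i * ∑ j ∈ Finset.Ioi i, Real.exp (-β) * (1 - β * x j) := by
        simp only [Finset.mul_sum]
        refine Finset.sum_congr rfl fun i _ => Finset.sum_congr rfl fun j _ => ?_
        rw [hρx]; ring
    _ ≤ _ := Finset.sum_le_sum fun i _ => mul_le_mul_of_nonneg_left
        (Finset.sum_le_sum fun j _ => hexp j) (hρ0 i)

theorem balanced_exponent_neg {k l a q β : ℝ} (hk : 3 ≤ k) (hl : 1 ≤ l)
    (ha : k * l - l / 2 - 1 / 2 + 21 * (l / k) / 2 ≤ a)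
    (hβ : β = 2 * k * l / (k - 1)) (hq : 1 - 2 * l / (k - 1) ≤ q * k ^ 2)
    (hq0 : 0 ≤ q) (hq1 : q * k ^ 2 ≤ 1) :
    l - a * (1 / k + (1 / k) ^ 2 / 2) - q * (k - 1) / 2 + q ^ 2 * (1 + β) ^ 2 * k ^ 3 / (4 * a)
      < 0 := by
  have hk0 : 0 < k := by linarith
  have hk1 : 0 < k - 1 := by linarith
  have hlk : 0 < l / k := by positivity
  have ha0 : k * l / 2 ≤ a := by nlinarith
  have hapos : 0 < a := lt_of_lt_of_le (by positivity) ha0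
  have hβ3 : β ≤ 3 * l := by
    rw [hβ, div_le_iff₀ hk1]; nlinarith
  have hβ0 : 0 ≤ β := by rw [hβ]; positivity
  have h1 : q ^ 2 * (1 + β) ^ 2 * k ^ 3 / (4 * a) ≤ 8 * l / k ^ 2 := by
    rw [div_le_div_iff₀ (by positivity) (by positivity)]
    have hb : (1 + β) ^ 2 ≤ (4 * l) ^ 2 := by gcongr; linarith
    have hc : (q * k ^ 2) ^ 2 ≤ 1 := by
      rw [sq_le_one_iff₀ (by positivity)]; exact hq1
    calc q ^ 2 * (1 + β) ^ 2 * k ^ 3 * k ^ 2 = (q * k ^ 2) ^ 2 * (1 + β) ^ 2 * k := by ring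
      _ ≤ 1 * (4 * l) ^ 2 * k := by gcongr
      _ = 8 * l * (4 * (k * l / 2)) := by ring
      _ ≤ _ := by gcongr
  have h2 : (k - 1 - 2 * l) / (2 * k ^ 2) ≤ q * (k - 1) / 2 := by
    have : (1 - 2 * l / (k - 1)) * (k - 1) ≤ q * k ^ 2 * (k - 1) := by gcongr
    have e : (1 - 2 * l / (k - 1)) * (k - 1) = k - 1 - 2 * l := by field_simp
    rw [e] at this
    rw [div_le_div_iff₀ (by positivity) (by positivity)]
    linarith
  have h3 : (k * l - l / 2 - 1 / 2 + 21 * (l / k) / 2) * (1 / k + (1 / k) ^ 2 / 2)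
      ≤ a * (1 / k + (1 / k) ^ 2 / 2) := by gcongr
  have h4 : l - (k * l - l / 2 - 1 / 2 + 21 * (l / k) / 2) * (1 / k + (1 / k) ^ 2 / 2)
      - (k - 1 - 2 * l) / (2 * k ^ 2) + 8 * l / k ^ 2 < 0 := by
    have e : l - (k * l - l / 2 - 1 / 2 + 21 * (l / k) / 2) * (1 / k + (1 / k) ^ 2 / 2)
      - (k - 1 - 2 * l) / (2 * k ^ 2) + 8 * l / k ^ 2 =
      (-(5 * l - 3) / 4 - 21 * l / (4 * k)) / k ^ 2 := by
      field_simp; ring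
    rw [e]
    apply div_neg_of_neg_of_pos _ (by positivity)
    have : 0 < 21 * l / (4 * k) := by positivity
    linarith
  linarith

theorem exists_exponent_gap {k : ℕ} (hk : 3 ≤ k) {a : ℝ}
    (ha : k * Real.log k - Real.log k / 2 - 1 / 2 + 21 * (Real.log k / k) / 2 ≤ a) :
    0 < a ∧ ∃ η > 0, ∀ ρ : Fin k → ℝ, (∀ i, 0 ≤ ρ i) → ∑ i, ρ i = 1 →
      Real.log k + a * (Real.log (1 - 1 / k) - 1)
        + ∑ i, ρ i * ∑ j ∈ Finset.Ioi i,
          (2 * a * k / (k - 1) * ρ j - Real.exp (-(2 * a * k / (k - 1) * ρ j))) ≤ -η := by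
  have hk' : (3 : ℝ) ≤ k := by exact_mod_cast hk
  obtain ⟨l, hl⟩ : ∃ l, Real.log k = l := ⟨_, rfl⟩
  have hl1 : 1 ≤ l := by
    rw [← hl, Real.le_log_iff_exp_le (by linarith)]
    exact (Real.exp_one_lt_d9.le.trans (by norm_num)).trans hk'
  rw [hl] at ha ⊢
  have hk0 : (0 : ℝ) < k := by linarith
  have hk1 : (0 : ℝ) < k - 1 := by linarith
  have hlk : 0 < l / k := by positivity
  have hapos : 0 < a := by nlinarith
  refine ⟨hapos, ?_⟩
  have hlog : Real.log (1 - 1 / k) ≤ -(1 / k + (1 / k : ℝ) ^ 2 / 2) :=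
    log_one_sub_le (by positivity) (by rw [div_lt_one hk0]; linarith)
  have halog := mul_le_mul_of_nonneg_left hlog hapos.le
  have hsplit : ∀ ρ : Fin k → ℝ, ∑ i, ρ i = 1 → ∑ i, ρ i * ∑ j ∈ Finset.Ioi i,
      (2 * a * k / (k - 1) * ρ j - Real.exp (-(2 * a * k / (k - 1) * ρ j)))
      = a - a / (k * (k - 1)) * ∑ i, (k * ρ i - 1) ^ 2
        - ∑ i, ρ i * ∑ j ∈ Finset.Ioi i, Real.exp (-(2 * a * k / (k - 1) * ρ j)) := by
    intro ρ hρ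
    rw [← pair_sum_eq hk a ρ hρ]
    simp only [Finset.sum_sub_distrib, mul_sub (ρ _)]
  rcases le_total (k * l) a with hbig | hsmall
  · refine ⟨-(l - a * (1 / k + (1 / k) ^ 2 / 2)), ?_, fun ρ hρ0 hρ => ?_⟩
    · have h1 : k * l * (1 / k + (1 / k : ℝ) ^ 2 / 2) ≤ a * (1 / k + (1 / k) ^ 2 / 2) := by gcongr
      have e : k * l * (1 / k + (1 / k : ℝ) ^ 2 / 2) = l + l / k / 2 := by field_simp
      linarith
    · rw [hsplit ρ hρ]
      have h1 : 0 ≤ ∑ i, ρ i * ∑ j ∈ Finset.Ioi i, Real.exp (-(2 * a * k / (k - 1) * ρ j)) :=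
        Finset.sum_nonneg fun i _ => mul_nonneg (hρ0 i)
          (Finset.sum_nonneg fun j _ => (Real.exp_pos _).le)
      have h2 : 0 ≤ a / (k * (k - 1)) * ∑ i, (k * ρ i - 1) ^ 2 := by positivity
      linarith
  · obtain ⟨β, hβ⟩ : ∃ β : ℝ, β = 2 * k * l / (k - 1) := ⟨_, rfl⟩
    have hβ0 : 0 ≤ β := by rw [hβ]; positivity
    have hβe : -β = -(2 * l) + -(2 * l / (k - 1)) := by rw [hβ]; field_simp; ring
    have hqk : Real.exp (-β) * k ^ 2 = Real.exp (-(2 * l / (k - 1))) := by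
      have : (k : ℝ) ^ 2 = Real.exp (2 * l) := by
        rw [← hl, mul_comm, Real.exp_mul, Real.exp_log hk0]; norm_num
      rw [this, ← Real.exp_add, hβe]; ring_nf
    have hneg := balanced_exponent_neg (q := Real.exp (-β)) hk' hl1 ha hβ
      (by rw [hqk]; linarith [Real.add_one_le_exp (-(2 * l / (k - 1)))]) (Real.exp_pos _).le
      (by rw [hqk, Real.exp_le_one_iff]; simp only [Left.neg_nonpos_iff]; positivity)
    refine ⟨_, neg_pos.2 hneg, fun ρ hρ0 hρ => ?_⟩
    rw [hsplit ρ hρ]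
    have hr := rigid_sum_ge hk (α := 2 * a * k / (k - 1)) (β := β) hβ0 (by
      rw [hβ, div_le_iff₀ hk1]
      have : k * (2 * k * l / (k - 1)) * ((k : ℝ) - 1) = 2 * (k * l) * k := by field_simp
      rw [this]; gcongr) ρ hρ0 hρ
    have hquad : Real.exp (-β) * ((1 + β) / k) * ∑ j : Fin k, (j : ℝ) * (k * ρ j - 1)
        - a / (k * (k - 1)) * ∑ i, (k * ρ i - 1) ^ 2
        ≤ Real.exp (-β) ^ 2 * (1 + β) ^ 2 * k ^ 3 / (4 * a) := by
      rw [Finset.mul_sum, Finset.mul_sum, ← Finset.sum_sub_distrib]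
      have : ∀ j : Fin k, Real.exp (-β) * ((1 + β) / k) * ((j : ℝ) * (k * ρ j - 1))
          - a / (k * (k - 1)) * (k * ρ j - 1) ^ 2
          ≤ Real.exp (-β) ^ 2 * (1 + β) ^ 2 * k ^ 2 / (4 * a) := by
        intro j
        obtain ⟨y, hy⟩ : ∃ y, k * ρ j - 1 = y := ⟨_, rfl⟩
        obtain ⟨q, hq⟩ : ∃ q, Real.exp (-β) = q := ⟨_, rfl⟩
        rw [hy, hq]
        have hj : ((j : ℕ) : ℝ) ≤ k := by exact_mod_cast j.2.le
        have h1 : a / k ^ 2 * y ^ 2 ≤ a / (k * (k - 1)) * y ^ 2 := by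
          gcongr; nlinarith
        have h2 : q * ((1 + β) / k) * (j * y) - a / k ^ 2 * y ^ 2
            ≤ q ^ 2 * (1 + β) ^ 2 * (j : ℝ) ^ 2 / (4 * a) := by
          have : q ^ 2 * (1 + β) ^ 2 * (j : ℝ) ^ 2 / (4 * a)
              - (q * ((1 + β) / k) * (j * y) - a / k ^ 2 * y ^ 2)
              = (q * (1 + β) * j - 2 * a * y / k) ^ 2 / (4 * a) := by
            field_simp; ring
          have h3 : 0 ≤ (q * (1 + β) * j - 2 * a * y / k) ^ 2 / (4 * a) := by positivity
          linarith
        have h3 : q ^ 2 * (1 + β) ^ 2 * (j : ℝ) ^ 2 / (4 * a)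
            ≤ q ^ 2 * (1 + β) ^ 2 * k ^ 2 / (4 * a) := by gcongr
        linarith
      refine (Finset.sum_le_sum fun j _ => this j).trans (le_of_eq ?_)
      simp; ring
    nlinarith

theorem factorial_le_mul_pow {m : ℕ} (hm : 1 ≤ m) :
    (m.factorial : ℝ) ≤ Real.exp 1 * m * (m / Real.exp 1) ^ m := by
  induction m, hm using Nat.le_induction with
  | base => simp
  | succ t ht ih =>
    have ht0 : (0 : ℝ) < t := by exact_mod_cast ht
    have he := Real.exp_pos 1
    have key : Real.exp 1 * (t : ℝ) ^ (t + 1) ≤ (t + 1 : ℝ) ^ (t + 1) := by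
      have h1 : (t : ℝ) / (t + 1) ≤ Real.exp (-(1 / (t + 1))) := by
        have := Real.add_one_le_exp (-(1 / (t + 1 : ℝ)))
        refine le_trans (le_of_eq ?_) this
        field_simp; ring
      have h2 : ((t : ℝ) / (t + 1)) ^ (t + 1) ≤ Real.exp (-1) := by
        calc _ ≤ Real.exp (-(1 / (t + 1))) ^ (t + 1) := by gcongr
          _ = Real.exp (-1) := by
            rw [← Real.exp_nat_mul]; congr 1; push_cast; field_simp
      rw [div_pow, div_le_iff₀ (by positivity), Real.exp_neg, ← div_eq_inv_mul,
        le_div_iff₀ he] at h2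
      linarith
    rw [Nat.factorial_succ, Nat.cast_mul]
    calc ((t + 1 : ℕ) : ℝ) * t.factorial
        ≤ (t + 1 : ℕ) * (Real.exp 1 * t * (t / Real.exp 1) ^ t) := by gcongr
      _ = ((t + 1 : ℝ) / Real.exp 1 ^ t) * (Real.exp 1 * (t : ℝ) ^ (t + 1)) := by
        rw [div_pow]; push_cast; field_simp; ring
      _ ≤ ((t + 1 : ℝ) / Real.exp 1 ^ t) * (t + 1 : ℝ) ^ (t + 1) := by gcongr
      _ = _ := by rw [div_pow]; push_cast; field_simp; ring

/-- No vertex can be recolored with a larger color. -/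
def IsRigid {n k : ℕ} (E : Finset (Sym2 (Fin n))) (σ : Fin n → Fin k) : Prop :=
  ∀ v : Fin n, ∀ j, σ v < j → ∃ w, σ w = j ∧ s(v, w) ∈ E

theorem exists_rigid_coloring {n k : ℕ} {E : Finset (Sym2 (Fin n))}
    (h : ∃ σ : Fin n → Fin k, IsColoring E σ) :
    ∃ σ : Fin n → Fin k, IsColoring E σ ∧ IsRigid E σ := by
  classical
  obtain ⟨σ, hσ, hmax⟩ := Finset.exists_max_image
    (Finset.univ.filter fun σ : Fin n → Fin k => IsColoring E σ) (fun σ => ∑ v, (σ v : ℕ))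
    (by obtain ⟨σ, hσ⟩ := h; exact ⟨σ, by simpa using hσ⟩)
  simp only [Finset.mem_filter, Finset.mem_univ, true_and] at hσ hmax
  refine ⟨σ, hσ, fun v j hj => ?_⟩
  by_contra! hno
  have hcol : IsColoring E (Function.update σ v j) := by
    intro u w huw
    have hne : u ≠ w := fun e => hσ u w huw (congrArg σ e)
    by_cases hu : u = v
    · subst hu
      rw [Function.update_self, Function.update_of_ne hne.symm]
      exact fun e => hno w e.symm huw
    · by_cases hw : w = v
      · subst hw
        rw [Function.update_self, Function.update_of_ne hne]
        exact fun e => hno u e (Sym2.eq_swap ▸ huw)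
      · rw [Function.update_of_ne hu, Function.update_of_ne hw]
        exact hσ u w huw
  refine absurd (hmax _ hcol) (not_le.2 ?_)
  refine Finset.sum_lt_sum (fun u _ => ?_) ⟨v, Finset.mem_univ _, by simpa using hj⟩
  by_cases hu : u = v
  · subst hu; simpa using hj.le
  · rw [Function.update_of_ne hu]

open Classical in
/-- The neighbors of `v` of color `j`, recorded only if `j` exceeds the color of `v`. -/
noncomputable def upNeighbors {n k : ℕ} (σ : Fin n → Fin k) (E : Finset (Sym2 (Fin n)))
    (b : Fin n × Fin k) : Finset (Fin n) :=
  {w | σ b.1 < b.2 ∧ σ w = b.2 ∧ s(b.1, w) ∈ E}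

theorem mem_upNeighbors {n k : ℕ} {σ : Fin n → Fin k} {E : Finset (Sym2 (Fin n))}
    {b : Fin n × Fin k} {w : Fin n} :
    w ∈ upNeighbors σ E b ↔ σ b.1 < b.2 ∧ σ w = b.2 ∧ s(b.1, w) ∈ E := by
  simp [upNeighbors]

theorem exists_ordered_of_mem {n k : ℕ} {σ : Fin n → Fin k} {E : Finset (Sym2 (Fin n))}
    (hE : IsColoring E σ) {e : Sym2 (Fin n)} (he : e ∈ E) :
    ∃ v w, e = s(v, w) ∧ σ v < σ w := by
  induction e using Sym2.ind with
  | _ v w =>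
    rcases lt_or_gt_of_ne (hE v w he) with h | h
    · exact ⟨v, w, rfl, h⟩
    · exact ⟨w, v, Sym2.eq_swap, h⟩

theorem sum_card_upNeighbors {n k : ℕ} {σ : Fin n → Fin k} {E : Finset (Sym2 (Fin n))}
    (hE : IsColoring E σ) : ∑ b, (upNeighbors σ E b).card = E.card := by
  rw [← Finset.card_sigma]
  refine Finset.card_bij (fun p _ => s(p.1.1, p.2)) ?_ ?_ ?_
  · rintro ⟨b, w⟩ h
    simp only [Finset.mem_sigma, mem_upNeighbors] at h
    exact h.2.2.2
  · rintro ⟨⟨v, j⟩, w⟩ h ⟨⟨v', j'⟩, w'⟩ h' heq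
    simp only [Finset.mem_sigma, mem_upNeighbors] at h h'
    obtain ⟨-, h1, rfl, -⟩ := h
    obtain ⟨-, h1', rfl, -⟩ := h'
    rcases Sym2.eq_iff.1 heq with ⟨rfl, rfl⟩ | ⟨rfl, rfl⟩
    · rfl
    · exact absurd h1 h1'.not_gt
  · intro e he
    obtain ⟨v, w, rfl, h⟩ := exists_ordered_of_mem hE he
    exact ⟨⟨(v, σ w), w⟩, by simp [mem_upNeighbors, h, he], rfl⟩

theorem upNeighbors_injOn {n k : ℕ} (σ : Fin n → Fin k) :
    Set.InjOn (upNeighbors σ) {E | IsColoring E σ} := by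
  have key : ∀ E E' : Finset (Sym2 (Fin n)), IsColoring E σ →
      upNeighbors σ E = upNeighbors σ E' → E ⊆ E' := by
    intro E E' hE h e he
    obtain ⟨v, w, rfl, hlt⟩ := exists_ordered_of_mem hE he
    have : w ∈ upNeighbors σ E (v, σ w) := mem_upNeighbors.2 ⟨hlt, rfl, he⟩
    rw [h] at this
    exact (mem_upNeighbors.1 this).2.2
  exact fun E hE E' hE' h => (key E E' hE h).antisymm (key E' E hE' h.symm)

/-- The size of a color class. -/
def classSize {n k : ℕ} (σ : Fin n → Fin k) (j : Fin k) : ℕ :=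
  (Finset.univ.filter fun w => σ w = j).card

theorem one_add_pow_sub_one_le {x : ℝ} (hx : 0 ≤ x) (c : ℕ) :
    (1 + x) ^ c - 1 ≤ Real.exp (x * c - Real.exp (-(x * c))) := by
  have h1 : (1 + x) ^ c ≤ Real.exp (x * c) := by
    rw [mul_comm, Real.exp_nat_mul]
    gcongr
    linarith [Real.add_one_le_exp x]
  have h2 := Real.add_one_le_exp (-Real.exp (-(x * c)))
  calc (1 + x) ^ c - 1 ≤ Real.exp (x * c) * (-Real.exp (-(x * c)) + 1) := by
        rw [mul_add, mul_neg, ← Real.exp_add]; simp; linarith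
    _ ≤ Real.exp (x * c) * Real.exp (-Real.exp (-(x * c))) := by gcongr
    _ = _ := by rw [← Real.exp_add, sub_eq_add_neg]

open Classical in
/-- Generating function bound for the number of edge sets for which `σ` is a rigid coloring. -/
theorem pow_mul_card_rigid_le {n k : ℕ} (σ : Fin n → Fin k) (m : ℕ) {x : ℝ} (hx : 0 ≤ x) :
    x ^ m * ((Finset.univ.filter fun E : Finset (Sym2 (Fin n)) =>
        E.card = m ∧ IsColoring E σ ∧ IsRigid E σ).card : ℝ)
      ≤ Real.exp (∑ v, ∑ j ∈ Finset.Ioi (σ v),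
          (x * classSize σ j - Real.exp (-(x * classSize σ j)))) := by
  set F := Finset.univ.filter fun E : Finset (Sym2 (Fin n)) =>
        E.card = m ∧ IsColoring E σ ∧ IsRigid E σ with hF
  let t : Fin n × Fin k → Finset (Finset (Fin n)) := fun b =>
    if σ b.1 < b.2 then (Finset.univ.filter fun w => σ w = b.2).powerset.erase ∅ else {∅}
  have hmem : ∀ E ∈ F, upNeighbors σ E ∈ Fintype.piFinset t := by
    intro E hE
    simp only [hF, Finset.mem_filter, Finset.mem_univ, true_and] at hE
    rw [Fintype.mem_piFinset]
    intro b
    by_cases hb : σ b.1 < b.2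
    · simp only [t, hb, if_true, Finset.mem_erase, Finset.mem_powerset]
      obtain ⟨w, hw, hwE⟩ := hE.2.2 b.1 b.2 hb
      refine ⟨Finset.ne_empty_of_mem (mem_upNeighbors.2 ⟨hb, hw, hwE⟩), fun w hw => ?_⟩
      simpa using (mem_upNeighbors.1 hw).2.1
    · simp only [t, hb, if_false, Finset.mem_singleton]
      exact Finset.eq_empty_of_forall_notMem fun w hw => hb (mem_upNeighbors.1 hw).1
  have hinj : Set.InjOn (upNeighbors σ) (F : Set (Finset (Sym2 (Fin n)))) :=
    (upNeighbors_injOn σ).mono fun E hE => by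
      simp only [hF, Finset.coe_filter, Finset.mem_univ, true_and, Set.mem_ofPred_eq] at hE
      exact hE.2.1
  have hfac : ∀ b, ∑ S ∈ t b, x ^ S.card ≤ if σ b.1 < b.2 then
      Real.exp (x * classSize σ b.2 - Real.exp (-(x * classSize σ b.2))) else 1 := by
    intro b
    by_cases hb : σ b.1 < b.2
    · simp only [t, hb, if_true]
      rw [Finset.sum_erase_eq_sub (Finset.empty_mem_powerset _)]
      have := Finset.sum_pow_mul_eq_add_pow x 1 (Finset.univ.filter fun w => σ w = b.2)
      simp only [one_pow, mul_one] at this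
      rw [this, Finset.card_empty, pow_zero, add_comm x 1]
      exact one_add_pow_sub_one_le hx _
    · simp [t, hb]
  calc x ^ m * (F.card : ℝ) = ∑ E ∈ F, ∏ b, x ^ (upNeighbors σ E b).card := by
        rw [mul_comm, ← nsmul_eq_mul, ← Finset.sum_const]
        refine Finset.sum_congr rfl fun E hE => ?_
        simp only [hF, Finset.mem_filter, Finset.mem_univ, true_and] at hE
        rw [Finset.prod_pow_eq_pow_sum, sum_card_upNeighbors hE.2.1, hE.1]
    _ = ∑ p ∈ F.image (upNeighbors σ), ∏ b, x ^ (p b).card :=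
        (Finset.sum_image (f := fun p => ∏ b, x ^ (p b).card) hinj).symm
    _ ≤ ∑ p ∈ Fintype.piFinset t, ∏ b, x ^ (p b).card :=
        Finset.sum_le_sum_of_subset_of_nonneg (Finset.image_subset_iff.2 hmem)
          fun p _ _ => Finset.prod_nonneg fun b _ => by positivity
    _ = ∏ b, ∑ S ∈ t b, x ^ S.card := (Finset.prod_univ_sum t fun _ S => x ^ S.card).symm
    _ ≤ ∏ b : Fin n × Fin k, if σ b.1 < b.2 then
          Real.exp (x * classSize σ b.2 - Real.exp (-(x * classSize σ b.2))) else 1 :=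
        Finset.prod_le_prod (fun b _ => Finset.sum_nonneg fun S _ => by positivity)
          fun b _ => hfac b
    _ = _ := by
        rw [Fintype.prod_prod_type, Real.exp_sum]
        refine Finset.prod_congr rfl fun v _ => ?_
        rw [Real.exp_sum, ← Finset.prod_filter]
        congr 1
        ext j; simp

theorem card_graphSpace (n m : ℕ) : Nat.card (GraphSpace n m) = (n.choose 2).choose m := by
  classical
  have e : GraphSpace n m ≃
      {E // E ∈ ((Finset.univ.filter fun e : Sym2 (Fin n) => ¬ e.IsDiag).powersetCard m)} :=
    Equiv.subtypeEquivRight fun E => by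
      simp [Finset.mem_powersetCard, Finset.subset_iff, and_comm]
  rw [Nat.card_congr e, Nat.card_eq_fintype_card, Fintype.card_coe, Finset.card_powersetCard,
    ← Fintype.card_subtype, Sym2.card_subtype_not_diag, Fintype.card_fin]

open Classical in
theorem card_colorable_le (n m k : ℕ) :
    Nat.card {G : GraphSpace n m // ∃ σ : Fin n → Fin k, IsColoring G.1 σ}
      ≤ ∑ σ : Fin n → Fin k, (Finset.univ.filter fun E : Finset (Sym2 (Fin n)) =>
        E.card = m ∧ IsColoring E σ ∧ IsRigid E σ).card := by
  let U := Finset.univ.biUnion fun σ : Fin n → Fin k =>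
    Finset.univ.filter fun E : Finset (Sym2 (Fin n)) =>
        E.card = m ∧ IsColoring E σ ∧ IsRigid E σ
  calc _ ≤ Nat.card U := by
        refine Nat.card_le_card_of_injective (fun G => ⟨G.1.1, ?_⟩) ?_
        · obtain ⟨σ, h⟩ := exists_rigid_coloring G.2
          simp only [U, Finset.mem_biUnion, Finset.mem_univ, true_and, Finset.mem_filter]
          exact ⟨σ, G.1.2.1, h⟩
        · intro G H h
          exact Subtype.ext (Subtype.ext (Subtype.mk.inj h))
    _ = U.card := by simp
    _ ≤ _ := Finset.card_biUnion_le

theorem sum_classSize {n k : ℕ} (σ : Fin n → Fin k) : ∑ j, classSize σ j = n := by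
  have := Finset.card_eq_sum_card_fiberwise (f := σ) (s := Finset.univ) (t := Finset.univ)
    (fun _ _ => Finset.mem_coe.2 (Finset.mem_univ _))
  simpa [classSize] using this.symm

/-- First moment bound over rigid colorings, in terms of a bound `M` on the exponent. -/
theorem pow_mul_card_colorable_le {n m k : ℕ} (hn : 0 < n) {α M : ℝ} (hα : 0 ≤ α)
    (hM : ∀ ρ : Fin k → ℝ, (∀ i, 0 ≤ ρ i) → ∑ i, ρ i = 1 →
      ∑ i, ρ i * ∑ j ∈ Finset.Ioi i, (α * ρ j - Real.exp (-(α * ρ j))) ≤ M) :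
    (α / n) ^ m *
      (Nat.card {G : GraphSpace n m // ∃ σ : Fin n → Fin k, IsColoring G.1 σ} : ℝ)
      ≤ k ^ n * Real.exp (n * M) := by
  classical
  have hn' : (0 : ℝ) < n := by exact_mod_cast hn
  have hσ : ∀ σ : Fin n → Fin k, (α / n) ^ m *
      ((Finset.univ.filter fun E : Finset (Sym2 (Fin n)) =>
        E.card = m ∧ IsColoring E σ ∧ IsRigid E σ).card : ℝ) ≤ Real.exp (n * M) := by
    intro σ
    refine (pow_mul_card_rigid_le σ m (by positivity)).trans (Real.exp_le_exp.2 ?_)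
    have h := hM (fun j => classSize σ j / n) (fun j => by positivity) (by
      rw [← Finset.sum_div, ← Nat.cast_sum, sum_classSize, div_self hn'.ne'])
    rw [← Finset.sum_fiberwise_of_maps_to (s := Finset.univ) (t := Finset.univ) (g := σ)
      (fun _ _ => Finset.mem_univ _)]
    calc _ = ∑ i, (n : ℝ) * (classSize σ i / n * ∑ j ∈ Finset.Ioi i,
          (α * (classSize σ j / n) - Real.exp (-(α * (classSize σ j / n))))) := by
          refine Finset.sum_congr rfl fun i _ => ?_
          rw [Finset.sum_congr rfl (g := fun _ => ∑ j ∈ Finset.Ioi i,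
            (α * (classSize σ j / n) - Real.exp (-(α * (classSize σ j / n)))))]
          · rw [Finset.sum_const, nsmul_eq_mul, ← mul_assoc, mul_div_cancel₀ _ hn'.ne']
            rfl
          · intro v hv
            rw [(Finset.mem_filter.1 hv).2]
            exact Finset.sum_congr rfl fun j _ => by rw [div_mul_eq_mul_div, mul_div_assoc]
      _ ≤ n * M := by rw [← Finset.mul_sum]; gcongr
  calc _ ≤ (α / n) ^ m * ((∑ σ : Fin n → Fin k, (Finset.univ.filter fun
          E : Finset (Sym2 (Fin n)) => E.card = m ∧ IsColoring E σ ∧ IsRigid E σ).card : ℕ) : ℝ) := by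
        gcongr; exact card_colorable_le n m k
    _ = ∑ σ : Fin n → Fin k, (α / n) ^ m * ((Finset.univ.filter fun
          E : Finset (Sym2 (Fin n)) => E.card = m ∧ IsColoring E σ ∧ IsRigid E σ).card : ℝ) := by
        rw [Nat.cast_sum, Finset.mul_sum]
    _ ≤ ∑ _σ : Fin n → Fin k, Real.exp (n * M) := Finset.sum_le_sum fun σ _ => hσ σ
    _ = _ := by simp

theorem inv_choose_le {N m : ℕ} (hm : 1 ≤ m) {D : ℝ} (hD : 0 < D) (hDN : D ≤ N + 1 - m) :
    0 < (N.choose m : ℝ) ∧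
    1 / (N.choose m : ℝ) ≤ Real.exp 1 * m * (m / Real.exp 1 / D) ^ m := by
  have hle : D ≤ ((N + 1 - m : ℕ) : ℝ) := by
    have : ((N + 1 : ℕ) : ℝ) - m ≤ ((N + 1 - m : ℕ) : ℝ) := by
      rw [sub_le_iff_le_add]; exact_mod_cast le_tsub_add
    push_cast at this
    linarith
  have h1 : D ^ m ≤ m.factorial * (N.choose m : ℝ) := by
    calc D ^ m ≤ ((N + 1 - m : ℕ) : ℝ) ^ m := by gcongr
      _ ≤ _ := by
        have := Nat.pow_sub_le_descFactorial N m
        rw [Nat.descFactorial_eq_factorial_mul_choose] at this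
        exact_mod_cast this
  have hDm : 0 < D ^ m := by positivity
  have hc : 0 < (N.choose m : ℝ) := pos_of_mul_pos_right (hDm.trans_le h1) (by positivity)
  refine ⟨hc, ?_⟩
  rw [div_pow, ← mul_div_assoc, div_le_div_iff₀ hc hDm, one_mul]
  exact h1.trans (by gcongr; exact factorial_le_mul_pow hm)

theorem tendsto_base {a α : ℝ} (m : ℕ → ℕ)
    (hm : Tendsto (fun n : ℕ => (m n : ℝ) / n) atTop (nhds a)) :
    (∀ᶠ n : ℕ in atTop, 0 < ((n.choose 2 : ℕ) : ℝ) + 1 - m n) ∧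
    Tendsto (fun n : ℕ => n / α * ((m n : ℝ) / Real.exp 1 / (((n.choose 2 : ℕ) : ℝ) + 1 - m n)))
      atTop (nhds (2 * a / (α * Real.exp 1))) := by
  have hinv : Tendsto (fun n : ℕ => (1 : ℝ) / n) atTop (nhds 0) :=
    tendsto_const_div_atTop_nhds_zero_nat 1
  have hD : Tendsto (fun n : ℕ => (((n.choose 2 : ℕ) : ℝ) + 1 - m n) / n ^ 2) atTop
      (nhds (1 / 2)) := by
    have h := (((tendsto_const_nhds (x := (1 : ℝ))).sub hinv).div_const 2).add (hinv.pow 2)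
      |>.sub (hm.mul hinv)
    norm_num at h
    norm_num
    refine h.congr' ?_
    filter_upwards [eventually_gt_atTop 0] with n hn
    have hn' : (n : ℝ) ≠ 0 := by positivity
    rw [Nat.cast_choose_two]
    field_simp
  refine ⟨?_, ?_⟩
  · filter_upwards [hD.eventually (lt_mem_nhds (by norm_num : (0 : ℝ) < 1 / 2)),
      eventually_gt_atTop 0] with n h hn
    have hn' : (0 : ℝ) < n ^ 2 := by positivity
    exact (div_pos_iff_of_pos_right hn').1 h
  · have h := (hm.div hD (by norm_num)).div_const (α * Real.exp 1)
    have e : a / (1 / 2) / (α * Real.exp 1) = 2 * a / (α * Real.exp 1) := by ring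
    rw [e] at h
    refine h.congr' ?_
    filter_upwards [eventually_gt_atTop 0] with n hn
    have hn' : (n : ℝ) ≠ 0 := by positivity
    simp only [Pi.div_apply]
    rw [div_div_eq_mul_div, div_div, div_div, div_mul_div_comm]
    rw [show (m n : ℝ) / n * n ^ 2 = n * m n by field_simp]
    congr 1
    ring

theorem colorable_prob_tendsto_zero {k : ℕ} (hk : 3 ≤ k) {a η : ℝ} (ha : 0 < a) (hη : 0 < η)
    (hgap : ∀ ρ : Fin k → ℝ, (∀ i, 0 ≤ ρ i) → ∑ i, ρ i = 1 →
      Real.log k + a * (Real.log (1 - 1 / k) - 1)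
        + ∑ i, ρ i * ∑ j ∈ Finset.Ioi i,
          (2 * a * k / (k - 1) * ρ j - Real.exp (-(2 * a * k / (k - 1) * ρ j))) ≤ -η)
    (m : ℕ → ℕ) (hm1 : ∀ n, a * n ≤ m n) (hm2 : ∀ n, (m n : ℝ) ≤ a * n + 1) :
    Tendsto (fun n : ℕ => prob (fun G : GraphSpace n (m n) =>
      ∃ σ : Fin n → Fin k, IsColoring G.1 σ)) atTop (nhds 0) := by
  have hk' : (3 : ℝ) ≤ k := by exact_mod_cast hk
  have hk0 : (0 : ℝ) < k := by linarith
  have hk1 : (0 : ℝ) < k - 1 := by linarith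
  obtain ⟨α, hα⟩ : ∃ α : ℝ, α = 2 * a * k / (k - 1) := ⟨_, rfl⟩
  have hα0 : 0 < α := by rw [hα]; positivity
  obtain ⟨lr, hlr⟩ : ∃ lr, lr = Real.log (1 - 1 / k) - 1 := ⟨_, rfl⟩
  rw [← hα, ← hlr] at hgap
  have hpos : (0 : ℝ) < 1 - 1 / k := by
    rw [sub_pos, div_lt_one hk0]; linarith
  have hlr1 : lr ≤ -1 := by
    have := Real.log_nonpos hpos.le (by linarith [show (0 : ℝ) < 1 / k by positivity])
    linarith
  have hr : 2 * a / (α * Real.exp 1) = Real.exp lr := by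
    rw [hlr, Real.exp_sub, Real.exp_log hpos, hα]
    field_simp
  obtain ⟨δ, hδ⟩ : ∃ δ : ℝ, δ = min (η / (2 * a)) 1 := ⟨_, rfl⟩
  have hδ0 : 0 < δ := by rw [hδ]; positivity
  have hδ1 : δ ≤ 1 := hδ ▸ min_le_right _ _
  have hδη : a * δ ≤ η / 2 := by
    have : δ ≤ η / (2 * a) := hδ ▸ min_le_left _ _
    calc a * δ ≤ a * (η / (2 * a)) := by gcongr
      _ = η / 2 := by field_simp
  have hinv : Tendsto (fun n : ℕ => (1 : ℝ) / n) atTop (nhds 0) :=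
    tendsto_const_div_atTop_nhds_zero_nat 1
  have hm : Tendsto (fun n : ℕ => (m n : ℝ) / n) atTop (nhds a) := by
    have hup : Tendsto (fun n : ℕ => a + 1 / (n : ℝ)) atTop (nhds a) := by
      simpa using (tendsto_const_nhds (x := a)).add hinv
    refine tendsto_of_tendsto_of_tendsto_of_le_of_le' tendsto_const_nhds hup ?_ ?_
    · filter_upwards [eventually_gt_atTop 0] with n hn
      have hn' : (0 : ℝ) < n := by positivity
      rw [le_div_iff₀ hn']; exact hm1 n
    · filter_upwards [eventually_gt_atTop 0] with n hn
      have hn' : (0 : ℝ) < n := by positivity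
      rw [div_le_iff₀ hn', add_mul, one_div, inv_mul_cancel₀ hn'.ne']; exact hm2 n
  obtain ⟨hDpos, hB⟩ := tendsto_base (α := α) m hm
  rw [hr] at hB
  have hlim : Tendsto (fun n : ℕ => Real.exp 1 * (a * n + 1) * Real.exp (-(η / 2) * n)) atTop
      (nhds 0) := by
    have h1 : Tendsto (fun x : ℝ => x * Real.exp (-(η / 2) * x)) atTop (nhds 0) := by
      simpa using tendsto_rpow_mul_exp_neg_mul_atTop_nhds_zero 1 (η / 2) (by positivity)
    have h2 : Tendsto (fun x : ℝ => Real.exp (-(η / 2) * x)) atTop (nhds 0) := by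
      simpa using tendsto_rpow_mul_exp_neg_mul_atTop_nhds_zero 0 (η / 2) (by positivity)
    have h := (((h1.const_mul a).add h2).const_mul (Real.exp 1)).comp
      (tendsto_natCast_atTop_atTop (R := ℝ))
    simp only [mul_zero, add_zero] at h
    refine h.congr fun n => ?_
    simp only [Function.comp]
    ring
  refine squeeze_zero' (Eventually.of_forall fun n => by unfold prob; positivity) ?_ hlim
  filter_upwards [hDpos, eventually_gt_atTop 0,
    hB.eventually (gt_mem_nhds (Real.exp_lt_exp.2 (lt_add_of_pos_right lr hδ0)))] with n hD hn hlt
  have hn' : (0 : ℝ) < n := by positivity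
  have hm0 : 0 < m n := by
    have : (0 : ℝ) < m n := lt_of_lt_of_le (by positivity) (hm1 n)
    exact_mod_cast this
  obtain ⟨D, hDe⟩ : ∃ D : ℝ, D = ((n.choose 2 : ℕ) : ℝ) + 1 - m n := ⟨_, rfl⟩
  rw [← hDe] at hD hlt
  obtain ⟨hc, hinvc⟩ := inv_choose_le hm0 hD hDe.le
  have hcol := pow_mul_card_colorable_le (m := m n) hn hα0.le
    (M := -η - Real.log k - a * lr) (fun ρ h0 h1 => by linarith [hgap ρ h0 h1])
  have hkn : (k : ℝ) ^ n * Real.exp (n * (-η - Real.log k - a * lr))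
      = Real.exp (n * (-η - a * lr)) := by
    rw [← Real.exp_log (pow_pos hk0 n), Real.log_pow, ← Real.exp_add]
    ring_nf
  rw [hkn] at hcol
  have hcol' : (Nat.card {G : GraphSpace n (m n) // ∃ σ : Fin n → Fin k, IsColoring G.1 σ} : ℝ)
      ≤ (n / α) ^ m n * Real.exp (n * (-η - a * lr)) := by
    have e : (n / α : ℝ) ^ m n * (α / n) ^ m n = 1 := by
      rw [← mul_pow, div_mul_div_cancel₀ hα0.ne', div_self hn'.ne', one_pow]
    calc _ = (n / α : ℝ) ^ m n * ((α / n) ^ m n * (Nat.card {G : GraphSpace n (m n) //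
          ∃ σ : Fin n → Fin k, IsColoring G.1 σ} : ℝ)) := by rw [← mul_assoc, e, one_mul]
      _ ≤ _ := by gcongr
  have hbase : (n / α * ((m n : ℝ) / Real.exp 1 / D)) ^ m n ≤ Real.exp ((lr + δ) * (a * n)) := by
    calc _ ≤ Real.exp (lr + δ) ^ m n := by gcongr
      _ = Real.exp ((lr + δ) * m n) := by rw [← Real.exp_nat_mul, mul_comm]
      _ ≤ _ := Real.exp_le_exp.2 (mul_le_mul_of_nonpos_left (hm1 n) (by linarith))
  unfold prob
  rw [card_graphSpace, div_eq_mul_one_div]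
  calc _ ≤ (n / α) ^ m n * Real.exp (n * (-η - a * lr))
        * (Real.exp 1 * m n * (m n / Real.exp 1 / D) ^ m n) := by gcongr
    _ = Real.exp 1 * m n * ((n / α * ((m n : ℝ) / Real.exp 1 / D)) ^ m n
        * Real.exp (n * (-η - a * lr))) := by rw [mul_pow]; ring
    _ ≤ Real.exp 1 * (a * n + 1) * (Real.exp ((lr + δ) * (a * n))
        * Real.exp (n * (-η - a * lr))) := by gcongr; exact hm2 n
    _ ≤ Real.exp 1 * (a * n + 1) * Real.exp (-(η / 2) * n) := by
        rw [← Real.exp_add]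
        gcongr
        nlinarith

theorem statement0 :
    ∃ (k₀ : ℕ) (ε : ℕ → ℝ), Tendsto ε atTop (nhds 0) ∧
      ∀ k : ℕ, k₀ ≤ k → ∀ d : ℝ,
        2 * k * Real.log k - Real.log k - 1 + ε k ≤ d →
        Tendsto (fun n : ℕ =>
            prob (fun G : GraphSpace n ⌈d * n / 2⌉₊ =>
              ∃ σ : Fin n → Fin k, IsColoring G.1 σ))
          atTop (nhds 0) := by
  refine ⟨3, fun k => 21 * (Real.log k / k), ?_, fun k hk d hd => ?_⟩
  · have h : Tendsto (fun x : ℝ => Real.log x / x) atTop (nhds 0) := by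
      simpa using Real.tendsto_pow_log_div_mul_add_atTop 1 0 1 one_ne_zero
    simpa using (h.comp tendsto_natCast_atTop_atTop).const_mul 21
  · obtain ⟨ha, η, hη, hgap⟩ := exists_exponent_gap hk (a := d / 2) (by linarith)
    refine colorable_prob_tendsto_zero hk ha hη hgap _ (fun n => ?_) fun n => ?_
    · rw [div_mul_eq_mul_div]
      exact Nat.le_ceil _
    · rw [div_mul_eq_mul_div]
      exact (Nat.ceil_lt_add_one (by
        rw [← div_mul_eq_mul_div]; positivity)).le
end

section
/- There exist a constant k_0 ∈ ℕ and functions ε, η: ℕ → (0,∞) with ε_k → 0 and η_k → 0 as k → ∞ such that for every k ≥ k_0 and every real d with 2k·ln k − ln k − 4 + ε_k ≤ d ≤ 2k·ln k, the following holds w.h.p. for G = G(n,⌈dn/2⌉): every k-coloring σ of G has a set F(σ) ⊆ V that is δ_k-frozen with δ_k = 1/(k·ln k) and has size |F(σ)| ≥ (1 − η_k)·n. -/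
open Filter

/-- `F` is a `δ`-frozen set (of the `k`-coloring `σ` of the graph with edge set `E`):
every `k`-coloring `τ` that differs from `σ` somewhere on `F` differs from `σ`
on at least `δ·n` vertices of `F`. -/
def Frozen {n k : ℕ} (E : Finset (Sym2 (Fin n))) (σ : Fin n → Fin k)
    (F : Finset (Fin n)) (δ : ℝ) : Prop :=
  ∀ τ : Fin n → Fin k, IsColoring E τ → (∃ v ∈ F, τ v ≠ σ v) →
    δ * n ≤ ((F.filter (fun v => σ v ≠ τ v)).card : ℝ)

section RandomGraph

open Finset
open scoped Classical

/-- The potential edges of a graph on `Fin n`. -/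
noncomputable def nonDiag (n : ℕ) : Finset (Sym2 (Fin n)) :=
  (univ : Finset (Fin n)).offDiag.image (Function.uncurry Sym2.mk)

/-- The edge sets of the graphs with `n` vertices and `m` edges. -/
noncomputable def graphs (n m : ℕ) : Finset (Finset (Sym2 (Fin n))) :=
  powersetCard m (nonDiag n)

theorem card_nonDiag (n : ℕ) : (nonDiag n).card = n.choose 2 := by
  rw [nonDiag, Sym2.card_image_offDiag, card_univ, Fintype.card_fin]

theorem mk_mem_nonDiag {n : ℕ} {u v : Fin n} : s(u, v) ∈ nonDiag n ↔ u ≠ v := by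
  simp only [nonDiag, mem_image, mem_offDiag, mem_univ, true_and, Prod.exists, Function.uncurry,
    Sym2.eq_iff]
  constructor
  · rintro ⟨a, b, hab, ⟨rfl, rfl⟩ | ⟨rfl, rfl⟩⟩
    · exact hab
    · exact hab.symm
  · intro h
    exact ⟨u, v, h, Or.inl ⟨rfl, rfl⟩⟩

theorem mem_nonDiag {n : ℕ} {e : Sym2 (Fin n)} : e ∈ nonDiag n ↔ ¬ e.IsDiag := by
  induction e with
  | _ u v => rw [mk_mem_nonDiag, Sym2.mk_isDiag_iff]

theorem mem_graphs {n m : ℕ} {E : Finset (Sym2 (Fin n))} :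
    E ∈ graphs n m ↔ E.card = m ∧ ∀ e ∈ E, ¬ e.IsDiag := by
  simp only [graphs, mem_powersetCard, subset_iff, mem_nonDiag, and_comm]

theorem prob_eq (n m : ℕ) (p : Finset (Sym2 (Fin n)) → Prop) :
    prob (fun G : GraphSpace n m => p G.1) =
      (((graphs n m).filter p).card : ℝ) / (graphs n m).card := by
  have h1 : Nat.card (GraphSpace n m) = (graphs n m).card := by
    rw [← Fintype.card_coe, ← Nat.card_eq_fintype_card]
    exact Nat.card_congr (Equiv.subtypeEquivRight fun E => mem_graphs.symm)
  have h2 : Nat.card {G : GraphSpace n m // p G.1} = ((graphs n m).filter p).card := by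
    rw [← Fintype.card_coe, ← Nat.card_eq_fintype_card]
    refine Nat.card_congr ((Equiv.subtypeSubtypeEquivSubtypeInter _ p).trans
      (Equiv.subtypeEquivRight fun E => ?_))
    rw [mem_filter, mem_graphs]
  rw [prob, h1, h2]

theorem choose_sub_mul_pow_le (N s m : ℕ) :
    (N - s).choose m * N ^ m ≤ N.choose m * (N - s) ^ m := by
  have h : (N - s).descFactorial m * N ^ m ≤ N.descFactorial m * (N - s) ^ m := by
    induction m with
    | zero => simp
    | succ m ih =>
      rw [Nat.descFactorial_succ, Nat.descFactorial_succ, pow_succ, pow_succ]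
      have h1 : (N - s - m) * N ≤ (N - m) * (N - s) := by
        rcases le_total (N - s) m with h | h
        · simp [Nat.sub_eq_zero_of_le h]
        · obtain ⟨c, hc⟩ := Nat.exists_eq_add_of_le h
          rcases le_total N s with h' | h'
          · simp [Nat.sub_eq_zero_of_le h']
          · obtain ⟨b, rfl⟩ := Nat.exists_eq_add_of_le h'
            have hb : s + b - s = b := by omega
            rw [hb] at hc ⊢
            have h3 : s + b - m = s + c := by omega
            have h4 : b - m = c := by omega
            rw [h3, h4, hc]
            nlinarith
      calc (N - s - m) * (N - s).descFactorial m * (N ^ m * N)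
          = ((N - s).descFactorial m * N ^ m) * ((N - s - m) * N) := by ring
        _ ≤ (N.descFactorial m * (N - s) ^ m) * ((N - m) * (N - s)) := Nat.mul_le_mul ih h1
        _ = _ := by ring
  rw [Nat.descFactorial_eq_factorial_mul_choose, Nat.descFactorial_eq_factorial_mul_choose,
    mul_assoc, mul_assoc] at h
  exact Nat.le_of_mul_le_mul_left h (Nat.factorial_pos m)

/-- The probability that the random graph avoids a given set of potential edges. -/
theorem card_disjoint_le {n m : ℕ} (hn : 0 < n.choose 2) {S : Finset (Sym2 (Fin n))}
    (hS : S ⊆ nonDiag n) :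
    (((graphs n m).filter (Disjoint · S)).card : ℝ) ≤
      (graphs n m).card * (1 - (S.card : ℝ) / n.choose 2) ^ m := by
  have h1 : (graphs n m).filter (Disjoint · S) = powersetCard m (nonDiag n \ S) := by
    ext E
    simp only [graphs, mem_filter, mem_powersetCard, subset_sdiff]
    tauto
  have hle : S.card ≤ n.choose 2 := card_nonDiag n ▸ card_le_card hS
  rw [h1, graphs, card_powersetCard, card_powersetCard, card_sdiff_of_subset hS, card_nonDiag]
  have h2 := choose_sub_mul_pow_le (n.choose 2) S.card m
  have hN : (0 : ℝ) < n.choose 2 := by exact_mod_cast hn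
  have h3 : (((n.choose 2 - S.card).choose m : ℕ) : ℝ) * (n.choose 2 : ℝ) ^ m ≤
      ((n.choose 2).choose m : ℕ) * ((n.choose 2 : ℝ) - S.card) ^ m := by
    rw [← Nat.cast_sub hle]
    exact_mod_cast h2
  rw [one_sub_div hN.ne', div_pow, mul_div_assoc', le_div_iff₀ (by positivity)]
  exact h3

/-- The pairs of distinct vertices that receive the same color. -/
noncomputable def monoPairs {n k : ℕ} (σ : Fin n → Fin k) : Finset (Sym2 (Fin n)) :=
  univ.biUnion fun j => (univ.filter (σ · = j)).offDiag.image (Function.uncurry Sym2.mk)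

theorem mk_mem_monoPairs {n k : ℕ} {σ : Fin n → Fin k} {u v : Fin n} :
    s(u, v) ∈ monoPairs σ ↔ u ≠ v ∧ σ u = σ v := by
  simp only [monoPairs, mem_biUnion, mem_image, mem_offDiag, mem_univ, true_and, Prod.exists,
    Function.uncurry, Sym2.eq_iff, mem_filter]
  constructor
  · rintro ⟨j, a, b, ⟨ha, hb, hab⟩, ⟨rfl, rfl⟩ | ⟨rfl, rfl⟩⟩
    · exact ⟨hab, ha.trans hb.symm⟩
    · exact ⟨hab.symm, hb.trans ha.symm⟩
  · rintro ⟨h, h'⟩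
    exact ⟨σ v, u, v, ⟨h', rfl, h⟩, Or.inl ⟨rfl, rfl⟩⟩

theorem card_monoPairs {n k : ℕ} (σ : Fin n → Fin k) :
    (monoPairs σ).card = ∑ j, (univ.filter (σ · = j)).card.choose 2 := by
  rw [monoPairs, card_biUnion]
  · simp only [Sym2.card_image_offDiag]
  · intro i _ j _ hij
    refine Finset.disjoint_left.2 fun e hi hj => ?_
    simp only [mem_image, mem_offDiag, mem_filter, mem_univ, true_and, Prod.exists,
      Function.uncurry] at hi hj
    obtain ⟨a, b, ⟨ha, hb, -⟩, rfl⟩ := hi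
    obtain ⟨c, d, ⟨hc, hd, -⟩, h⟩ := hj
    rw [Sym2.eq_iff] at h
    rcases h with ⟨rfl, rfl⟩ | ⟨rfl, rfl⟩
    · exact hij (ha.symm.trans hc)
    · exact hij (ha.symm.trans hd)

/-- A set `R` is closed if each of its vertices `v` can take a new color, all of whose neighbours
of `v` lie in `R`. -/
def Closed {n k : ℕ} (E : Finset (Sym2 (Fin n))) (σ : Fin n → Fin k) (R : Finset (Fin n)) : Prop :=
  ∀ v ∈ R, ∃ j, j ≠ σ v ∧ ∀ u, σ u = j → s(v, u) ∈ E → u ∈ R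

theorem Closed.union {n k : ℕ} {E : Finset (Sym2 (Fin n))} {σ : Fin n → Fin k}
    {R S : Finset (Fin n)} (hR : Closed E σ R) (hS : Closed E σ S) : Closed E σ (R ∪ S) := by
  intro v hv
  rcases mem_union.1 hv with h | h
  · obtain ⟨j, hj, h⟩ := hR v h
    exact ⟨j, hj, fun u hu hE => mem_union_left _ (h u hu hE)⟩
  · obtain ⟨j, hj, h⟩ := hS v h
    exact ⟨j, hj, fun u hu hE => mem_union_right _ (h u hu hE)⟩

theorem closed_ne {n k : ℕ} {E : Finset (Sym2 (Fin n))} {σ τ : Fin n → Fin k}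
    (hτ : IsColoring E τ) : Closed E σ (univ.filter fun v => σ v ≠ τ v) := by
  intro v hv
  refine ⟨τ v, fun h => (mem_filter.1 hv).2 h.symm, fun u hu hE => mem_filter.2 ⟨mem_univ _, ?_⟩⟩
  rw [hu]
  exact hτ v u hE

/-- If closed sets satisfy a dichotomy, then the complement of the largest small closed set is
frozen. -/
theorem exists_frozen {n k : ℕ} {E : Finset (Sym2 (Fin n))} {σ : Fin n → Fin k} {t r δ : ℝ}
    (ht : 0 ≤ t) (hδ : δ * n ≤ t)
    (h : ∀ R, Closed E σ R → (∀ j, ((R.filter (σ · = j)).card : ℝ) ≤ 2 * t) →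
      (∀ j, ((R.filter (σ · = j)).card : ℝ) ≤ t) ∧ (R.card : ℝ) ≤ r) :
    ∃ F : Finset (Fin n), (n : ℝ) - r ≤ F.card ∧ Frozen E σ F δ := by
  obtain ⟨M, hM, hmax⟩ := exists_max_image
    ((univ : Finset (Finset (Fin n))).filter fun R =>
      Closed E σ R ∧ ∀ j, ((R.filter (σ · = j)).card : ℝ) ≤ t) card
    ⟨∅, mem_filter.2 ⟨mem_univ _, by simp [Closed], by simp [ht]⟩⟩
  simp only [mem_filter, mem_univ, true_and] at hM hmax
  refine ⟨Mᶜ, ?_, ?_⟩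
  · have h1 := (h M hM.1 fun j => (hM.2 j).trans (by linarith)).2
    have h2 : (M.card : ℝ) + (Mᶜ.card : ℝ) = n := by
      exact_mod_cast (card_add_card_compl M).trans (Fintype.card_fin n)
    linarith
  · rintro τ hτ ⟨v, hv, hne⟩
    by_contra! hlt
    set D := univ.filter fun v => σ v ≠ τ v with hD
    have hcl : Closed E σ (M ∪ D) := hM.1.union (closed_ne hτ)
    have hsmall : ∀ j, (((M ∪ D).filter (σ · = j)).card : ℝ) ≤ 2 * t := by
      intro j
      have hsub : (M ∪ D).filter (σ · = j) ⊆
          M.filter (σ · = j) ∪ Mᶜ.filter (fun v => σ v ≠ τ v) := by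
        intro u hu
        simp only [hD, mem_filter, mem_union, mem_univ, true_and, mem_compl] at hu ⊢
        tauto
      have h1 : (((M ∪ D).filter (σ · = j)).card : ℝ) ≤
          (M.filter (σ · = j)).card + (Mᶜ.filter (fun v => σ v ≠ τ v)).card := by
        exact_mod_cast (card_le_card hsub).trans (card_union_le _ _)
      have h2 := hM.2 j
      have h3 : ((Mᶜ.filter (fun v => σ v ≠ τ v)).card : ℝ) < δ * n := by convert hlt
      linarith
    have hle := hmax _ ⟨hcl, (h _ hcl hsmall).1⟩
    have heq : M = M ∪ D := eq_of_subset_of_card_le subset_union_left hle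
    refine mem_compl.1 hv (heq ▸ mem_union_right _ ?_)
    exact mem_filter.2 ⟨mem_univ _, fun h => hne h.symm⟩

/-- The pairs that must not be edges if every `v ∈ R` has all its neighbours of color `J v`
in `R`. -/
noncomputable def cross {n k : ℕ} (σ : Fin n → Fin k) (R : Finset (Fin n)) (J : Fin n → Fin k) :
    Finset (Sym2 (Fin n)) :=
  (R.sigma fun v => univ.filter (σ · = J v) \ R).image fun p => s(p.1, p.2)

theorem card_cross {n k : ℕ} (σ : Fin n → Fin k) (R : Finset (Fin n)) (J : Fin n → Fin k) :
    (cross σ R J).card = ∑ v ∈ R, (univ.filter (σ · = J v) \ R).card := by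
  rw [cross, card_image_of_injOn, card_sigma]
  rintro ⟨a, b⟩ hab ⟨c, d⟩ hcd h
  simp only [coe_sigma, Set.mem_sigma_iff, mem_coe, Finset.mem_sdiff] at hab hcd
  simp only [Sym2.eq_iff] at h
  rcases h with ⟨rfl, rfl⟩ | ⟨rfl, rfl⟩
  · rfl
  · exact absurd hab.1 hcd.2.2

theorem card_monoPairs_union_cross {n k : ℕ} (σ : Fin n → Fin k) (R : Finset (Fin n))
    (J : Fin n → Fin k) (hJ : ∀ v ∈ R, J v ≠ σ v) :
    (monoPairs σ ∪ cross σ R J).card =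
      (monoPairs σ).card + ∑ v ∈ R, (univ.filter (σ · = J v) \ R).card := by
  rw [card_union_of_disjoint, card_cross]
  rw [Finset.disjoint_right]
  intro e he
  simp only [cross, mem_image, mem_sigma, Finset.mem_sdiff, mem_filter, mem_univ, true_and] at he
  obtain ⟨⟨a, b⟩, ⟨ha, hb, -⟩, rfl⟩ := he
  rw [mk_mem_monoPairs]
  rintro ⟨-, h⟩
  exact hJ a ha (hb.symm.trans h.symm)

theorem monoPairs_union_cross_subset {n k : ℕ} (σ : Fin n → Fin k) (R : Finset (Fin n))
    (J : Fin n → Fin k) : monoPairs σ ∪ cross σ R J ⊆ nonDiag n := by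
  intro e he
  rcases mem_union.1 he with h | h
  · induction e with
    | _ u v => exact mk_mem_nonDiag.2 (mk_mem_monoPairs.1 h).1
  · simp only [cross, mem_image, mem_sigma, Finset.mem_sdiff] at h
    obtain ⟨⟨a, b⟩, ⟨ha, -, hb⟩, rfl⟩ := h
    exact mk_mem_nonDiag.2 fun h => hb (h ▸ ha)

/-- A bound on the probability that `σ` is a coloring of the random graph. -/
noncomputable def properBound (n m : ℕ) {k : ℕ} (σ : Fin n → Fin k) : ℝ :=
  (1 - ((monoPairs σ).card : ℝ) / n.choose 2) ^ m

theorem card_monoPairs_le {n k : ℕ} (σ : Fin n → Fin k) : (monoPairs σ).card ≤ n.choose 2 := by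
  rw [← card_nonDiag]
  exact card_le_card (subset_union_left.trans (monoPairs_union_cross_subset σ ∅ σ))

theorem properBound_nonneg (n m : ℕ) {k : ℕ} (σ : Fin n → Fin k) : 0 ≤ properBound n m σ := by
  have h : ((monoPairs σ).card : ℝ) ≤ n.choose 2 := by exact_mod_cast card_monoPairs_le σ
  exact pow_nonneg (sub_nonneg.2 (div_le_one_of_le₀ h (Nat.cast_nonneg _))) m

theorem card_isColoring_le {n m k : ℕ} (hn : 0 < n.choose 2) (σ : Fin n → Fin k) :
    (((graphs n m).filter fun E => IsColoring E σ).card : ℝ) ≤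
      (graphs n m).card * properBound n m σ := by
  refine le_trans ?_ (card_disjoint_le (m := m) hn
    (subset_union_left.trans (monoPairs_union_cross_subset σ ∅ σ)))
  refine Nat.cast_le.2 (card_le_card (monotone_filter_right _ fun E _ hE => ?_))
  rw [Finset.disjoint_right]
  intro e he heE
  induction e with
  | _ u v => exact hE u v heE (mk_mem_monoPairs.1 he).2

theorem one_sub_add_div_pow_le {M L N a : ℝ} {m : ℕ} (hN : 0 < N) (hM : 0 ≤ M) (hL : 0 ≤ L)
    (h : M + L ≤ N) (ha : a ≤ m / N) :
    (1 - (M + L) / N) ^ m ≤ (1 - M / N) ^ m * Real.exp (-(a * L)) := by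
  have h1 : 1 - (M + L) / N ≤ (1 - M / N) * Real.exp (-(L / N)) := by
    have h2 := Real.add_one_le_exp (-(L / N))
    have h3 : 0 ≤ 1 - M / N := sub_nonneg.2 ((div_le_one hN).2 (by linarith))
    have h4 : 0 ≤ L / N := by positivity
    have h5 : 0 ≤ M / N := by positivity
    have h6 := mul_le_mul_of_nonneg_left h2 h3
    rw [add_div]
    nlinarith
  have h0 : 0 ≤ 1 - (M + L) / N := sub_nonneg.2 ((div_le_one hN).2 h)
  calc (1 - (M + L) / N) ^ m ≤ ((1 - M / N) * Real.exp (-(L / N))) ^ m :=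
        pow_le_pow_left₀ h0 h1 m
    _ = (1 - M / N) ^ m * Real.exp (-(m / N * L)) := by
        rw [mul_pow, ← Real.exp_nat_mul]
        congr 2
        ring
    _ ≤ _ := by
        have h3 : 0 ≤ 1 - M / N := sub_nonneg.2 ((div_le_one hN).2 (by linarith))
        gcongr

/-- A bound on the probability that `σ` is a coloring and a given set is closed. -/
theorem card_closed_le {n m k : ℕ} (hn : 0 < n.choose 2) (σ : Fin n → Fin k)
    (R : Finset (Fin n)) {a : ℝ} (ha : a ≤ m / n.choose 2) :
    (((graphs n m).filter fun E => IsColoring E σ ∧ Closed E σ R).card : ℝ) ≤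
      (graphs n m).card * properBound n m σ *
        (∑ j, Real.exp (-(a * (univ.filter (σ · = j) \ R).card))) ^ R.card := by
  set T : Fin n → Finset (Fin k) := fun v => if v ∈ R then univ.erase (σ v) else {σ v} with hT
  set f : Fin n → Fin k → ℝ := fun v j =>
    if v ∈ R then Real.exp (-(a * (univ.filter (σ · = j) \ R).card)) else 1 with hf
  have hsub : (graphs n m).filter (fun E => IsColoring E σ ∧ Closed E σ R) ⊆
      (Fintype.piFinset T).biUnion fun J =>
        (graphs n m).filter (Disjoint · (monoPairs σ ∪ cross σ R J)) := by
    intro E hE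
    obtain ⟨hE, hcol, hcl⟩ := mem_filter.1 hE
    have hcl' : ∀ v, ∃ j, v ∈ R → j ≠ σ v ∧ ∀ u, σ u = j → s(v, u) ∈ E → u ∈ R := fun v => by
      by_cases hv : v ∈ R
      · obtain ⟨j, hj⟩ := hcl v hv
        exact ⟨j, fun _ => hj⟩
      · exact ⟨σ v, fun h => absurd h hv⟩
    choose J hJ using hcl'
    refine mem_biUnion.2 ⟨fun v => if v ∈ R then J v else σ v, ?_, mem_filter.2 ⟨hE, ?_⟩⟩
    · refine Fintype.mem_piFinset.2 fun v => ?_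
      by_cases hv : v ∈ R
      · simp [hT, hv, (hJ v hv).1]
      · simp [hT, hv]
    · rw [Finset.disjoint_right]
      intro e he heE
      rcases mem_union.1 he with h | h
      · induction e with
        | _ u v => exact hcol u v heE (mk_mem_monoPairs.1 h).2
      · simp only [cross, mem_image, mem_sigma, Finset.mem_sdiff, mem_filter, mem_univ,
          true_and] at h
        obtain ⟨⟨v, u⟩, ⟨hv, hu, huR⟩, rfl⟩ := h
        simp only [hv, if_true] at hu
        exact huR ((hJ v hv).2 u hu heE)
  have hJ : ∀ J ∈ Fintype.piFinset T, ∀ v ∈ R, J v ≠ σ v := by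
    intro J hJ v hv
    have := Fintype.mem_piFinset.1 hJ v
    simp only [hT, hv, if_true, mem_erase] at this
    exact this.1
  have hN : (0 : ℝ) < n.choose 2 := by exact_mod_cast hn
  have hbound : ∀ J ∈ Fintype.piFinset T,
      (((graphs n m).filter (Disjoint · (monoPairs σ ∪ cross σ R J))).card : ℝ) ≤
        (graphs n m).card * properBound n m σ * ∏ v, f v (J v) := by
    intro J hJm
    refine (card_disjoint_le hn (monoPairs_union_cross_subset σ R J)).trans ?_
    have hc := card_monoPairs_union_cross σ R J (hJ J hJm)
    have hle : (monoPairs σ ∪ cross σ R J).card ≤ n.choose 2 :=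
      card_nonDiag n ▸ card_le_card (monoPairs_union_cross_subset σ R J)
    rw [hc] at hle ⊢
    rw [mul_assoc]
    refine mul_le_mul_of_nonneg_left ?_ (Nat.cast_nonneg _)
    have hprod : ∏ v, f v (J v) =
        Real.exp (-(a * (∑ v ∈ R, (univ.filter (σ · = J v) \ R).card : ℕ))) := by
      rw [Nat.cast_sum, mul_sum, ← sum_neg_distrib, Real.exp_sum, hf, prod_ite]
      simp
    rw [hprod, properBound, Nat.cast_add]
    exact one_sub_add_div_pow_le hN (Nat.cast_nonneg _) (Nat.cast_nonneg _)
      (by exact_mod_cast hle) ha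
  have hprod : ∏ v, ∑ j ∈ T v, f v j ≤
      (∑ j, Real.exp (-(a * (univ.filter (σ · = j) \ R).card))) ^ R.card := by
    rw [← prod_const, ← prod_subset (subset_univ R)]
    · refine prod_le_prod (fun v _ => sum_nonneg fun j _ => ?_) fun v hv => ?_
      · simp only [hf]
        split_ifs
        positivity
      · simp only [hT, hf, hv, if_true]
        exact sum_le_sum_of_subset_of_nonneg (subset_univ _) fun _ _ _ => (Real.exp_pos _).le
    · intro v _ hv
      simp [hT, hf, hv]
  calc (((graphs n m).filter fun E => IsColoring E σ ∧ Closed E σ R).card : ℝ)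
      ≤ ∑ J ∈ Fintype.piFinset T,
          (((graphs n m).filter (Disjoint · (monoPairs σ ∪ cross σ R J))).card : ℝ) := by
        exact_mod_cast (card_le_card hsub).trans card_biUnion_le
    _ ≤ ∑ J ∈ Fintype.piFinset T,
          (graphs n m).card * properBound n m σ * ∏ v, f v (J v) := sum_le_sum hbound
    _ = (graphs n m).card * properBound n m σ * ∏ v, ∑ j ∈ T v, f v j := by
        rw [← mul_sum, prod_univ_sum]
    _ ≤ _ := mul_le_mul_of_nonneg_left hprod
        (mul_nonneg (Nat.cast_nonneg _) (properBound_nonneg n m σ))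

/-- An exponential Chebyshev bound for weighted sums over vertex sets. -/
theorem sum_pow_card_le {n : ℕ} (A : Finset (Finset (Fin n))) (C : Finset (Fin n)) {w T r : ℝ}
    (hw : 0 ≤ w) (hT : 1 ≤ T) (h : ∀ R ∈ A, r ≤ ((R ∩ C).card : ℝ)) :
    ∑ R ∈ A, w ^ R.card ≤ Real.exp (w * n + w * T * C.card - r * Real.log T) := by
  have hT0 : 0 < T := by linarith
  set f : Fin n → ℝ := fun v => w * if v ∈ C then T else 1 with hf
  have hf0 : ∀ v, 0 ≤ f v := fun v => by
    simp only [hf]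
    split_ifs <;> positivity
  have hprod : ∀ R : Finset (Fin n), ∏ v ∈ R, f v = w ^ R.card * T ^ (R ∩ C).card := by
    intro R
    rw [hf, prod_mul_distrib, prod_const, prod_ite_mem, prod_const]
  have h1 : ∀ R ∈ A, w ^ R.card ≤ Real.exp (-(r * Real.log T)) * ∏ v ∈ R, f v := by
    intro R hR
    rw [hprod]
    have h2 : Real.exp (r * Real.log T) ≤ T ^ (R ∩ C).card := by
      rw [← Real.exp_log (pow_pos hT0 _), Real.log_pow]
      exact Real.exp_le_exp.2 (mul_le_mul_of_nonneg_right (h R hR) (Real.log_nonneg hT))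
    calc w ^ R.card = Real.exp (-(r * Real.log T)) * (w ^ R.card * Real.exp (r * Real.log T)) := by
          rw [mul_left_comm, ← Real.exp_add]
          simp
      _ ≤ _ := by gcongr
  calc ∑ R ∈ A, w ^ R.card ≤ ∑ R ∈ A, Real.exp (-(r * Real.log T)) * ∏ v ∈ R, f v :=
        sum_le_sum h1
    _ ≤ ∑ R, Real.exp (-(r * Real.log T)) * ∏ v ∈ R, f v :=
        sum_le_sum_of_subset_of_nonneg (subset_univ _) fun R _ _ =>
          mul_nonneg (Real.exp_pos _).le (prod_nonneg fun v _ => hf0 v)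
    _ = Real.exp (-(r * Real.log T)) * ∏ v, (1 + f v) := by
        rw [← mul_sum, prod_one_add, powerset_univ]
    _ ≤ Real.exp (-(r * Real.log T)) * Real.exp (∑ v, f v) := by
        rw [Real.exp_sum]
        refine mul_le_mul_of_nonneg_left (prod_le_prod (fun v _ => ?_) fun v _ => ?_)
          (Real.exp_pos _).le
        · linarith [hf0 v]
        · linarith [Real.add_one_le_exp (f v)]
    _ ≤ _ := by
        rw [← Real.exp_add]
        refine Real.exp_le_exp.2 ?_
        have h3 : ∑ v, f v ≤ w * n + w * T * C.card := by
          have h4 : ∀ v, f v ≤ w + if v ∈ C then w * T else 0 := by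
            intro v
            simp only [hf]
            split_ifs <;> linarith
          refine (sum_le_sum fun v _ => h4 v).trans ?_
          rw [sum_add_distrib, sum_ite_mem]
          simp [mul_comm]
        linarith

/-- The squared relative deviation of the color class sizes from their mean. -/
noncomputable def imbalance {n k : ℕ} (σ : Fin n → Fin k) : ℝ :=
  ∑ j, ((k : ℝ) * (univ.filter (σ · = j)).card / n - 1) ^ 2

theorem imbalance_nonneg {n k : ℕ} (σ : Fin n → Fin k) : 0 ≤ imbalance σ :=
  sum_nonneg fun _ _ => sq_nonneg _

theorem sum_card_class {n k : ℕ} (σ : Fin n → Fin k) (R : Finset (Fin n)) :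
    ∑ j, ((R.filter (σ · = j)).card : ℝ) = R.card := by
  exact_mod_cast (card_eq_sum_card_fiberwise (f := σ) (s := R) (t := univ)
    fun _ _ => mem_coe.2 (mem_univ _)).symm

theorem one_sub_monoPairs_div {n k : ℕ} (hn : 2 ≤ n) (hk : 0 < k) (σ : Fin n → Fin k) :
    1 - ((monoPairs σ).card : ℝ) / n.choose 2 =
      (1 + 1 / ((n : ℝ) - 1)) * (1 - 1 / k - imbalance σ / k ^ 2) := by
  have hn' : (2 : ℝ) ≤ n := by exact_mod_cast hn
  have hk' : (0 : ℝ) < k := by exact_mod_cast hk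
  have h0 : (n : ℝ) ≠ 0 := by positivity
  have h1 : (n : ℝ) - 1 ≠ 0 := by linarith
  have hsum := sum_card_class σ univ
  rw [card_univ, Fintype.card_fin] at hsum
  set c : Fin k → ℝ := fun j => ((univ.filter (σ · = j)).card : ℝ) with hc
  have hM : ((monoPairs σ).card : ℝ) = ((∑ j, c j ^ 2) - n) / 2 := by
    rw [card_monoPairs, Nat.cast_sum, ← hsum, ← sum_sub_distrib, sum_div]
    refine sum_congr rfl fun j _ => ?_
    rw [Nat.cast_choose_two]
    ring
  have hI : imbalance σ = k ^ 2 / n ^ 2 * (∑ j, c j ^ 2) - k := by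
    have h2 : ∀ j, ((k : ℝ) * c j / n - 1) ^ 2 =
        k ^ 2 / n ^ 2 * c j ^ 2 - 2 * k / n * c j + 1 := fun j => by
      field_simp
      ring
    rw [imbalance, sum_congr rfl fun j _ => h2 j, sum_add_distrib, sum_sub_distrib, ← mul_sum,
      ← mul_sum, hsum]
    simp only [sum_const, card_univ, Fintype.card_fin, nsmul_eq_mul, mul_one]
    field_simp
    ring
  rw [hM, hI, Nat.cast_choose_two]
  field_simp
  ring

theorem one_sub_le_exp_neg_add_sq {x : ℝ} (h0 : 0 ≤ x) (h1 : x < 1) :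
    1 - x ≤ Real.exp (-(x + x ^ 2 / 2)) := by
  have h := sum_le_hasSum (range 2) (fun i _ => by positivity)
    (Real.hasSum_pow_div_log_of_abs_lt_one (abs_lt.2 ⟨by linarith, h1⟩))
  norm_num [sum_range_succ] at h
  rw [← Real.log_le_iff_le_exp (by linarith)]
  linarith

theorem log_sub_le {k : ℕ} {d : ℝ} (hk : 0 < k) (hk4 : Real.log k + 4 ≤ k)
    (hd : 2 * k * Real.log k - Real.log k - 4 ≤ d) :
    Real.log k - d / 2 * (1 / k + (1 / k) ^ 2 / 2) ≤ 3 / k := by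
  have hk' : (0 : ℝ) < k := by exact_mod_cast hk
  set L := Real.log k
  have h1 : (2 * k * L - L - 4) / 2 * (1 / k + (1 / k) ^ 2 / 2) ≤
      d / 2 * (1 / k + (1 / k) ^ 2 / 2) := by gcongr
  have h2 : (2 * k * L - L - 4) / 2 * (1 / k + (1 / k) ^ 2 / 2) =
      L - 2 / k - (L + 4) / (4 * k ^ 2) := by
    field_simp
    ring
  have h3 : (L + 4) / (4 * k ^ 2) ≤ 1 / k := by
    rw [div_le_div_iff₀ (by positivity) hk']
    nlinarith
  have h4 : (3 : ℝ) / k = 2 / k + 1 / k := by ring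
  linarith

/-- A first moment bound: unbalanced maps are unlikely to be colorings. -/
theorem properBound_le {n m k : ℕ} {d : ℝ} (hn : 2 ≤ n) (hk : 2 ≤ k)
    (hk4 : Real.log k + 4 ≤ k) (hd : 2 * k * Real.log k - Real.log k - 4 ≤ d)
    (hd' : k * Real.log k ≤ d) (hm : d * n / 2 ≤ m) (hm' : (m : ℝ) ≤ d * n / 2 + 1)
    (σ : Fin n → Fin k) :
    properBound n m σ ≤ Real.exp (d + 1) *
      Real.exp (n * (3 / k - Real.log k / (2 * k) * imbalance σ)) / (k : ℝ) ^ n := by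
  have hn' : (2 : ℝ) ≤ n := by exact_mod_cast hn
  have hk' : (2 : ℝ) ≤ k := by exact_mod_cast hk
  have hk0 : (0 : ℝ) < k := by linarith
  have hI := imbalance_nonneg σ
  have hL : 0 ≤ Real.log k := Real.log_nonneg (by linarith)
  have hd0 : 0 ≤ d := le_trans (by positivity) hd'
  set I := imbalance σ
  set L := Real.log k with hLdef
  have hbase : 1 - ((monoPairs σ).card : ℝ) / n.choose 2 ≤
      Real.exp (1 / ((n : ℝ) - 1) - (1 / k + (1 / k) ^ 2 / 2) - I / k ^ 2) := by
    have hexp : Real.exp (1 / ((n : ℝ) - 1) - (1 / k + (1 / k) ^ 2 / 2) - I / k ^ 2) =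
        Real.exp (1 / ((n : ℝ) - 1)) *
          (Real.exp (-(1 / k + (1 / k) ^ 2 / 2)) * Real.exp (-(I / k ^ 2))) := by
      rw [← Real.exp_add, ← Real.exp_add]
      congr 1
      ring
    rw [one_sub_monoPairs_div hn (by omega) σ, hexp]
    have h1 : (1 : ℝ) / k < 1 := by rw [div_lt_one hk0]; linarith
    have h2 : 0 ≤ I / (k : ℝ) ^ 2 := by positivity
    have h3 := one_sub_le_exp_neg_add_sq (x := 1 / (k : ℝ)) (by positivity) h1
    have h4 := Real.add_one_le_exp (-(I / (k : ℝ) ^ 2))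
    have h5 := Real.add_one_le_exp (1 / ((n : ℝ) - 1))
    have h6 : 0 ≤ 1 / ((n : ℝ) - 1) := div_nonneg zero_le_one (by linarith)
    have h7 : 1 - 1 / (k : ℝ) - I / k ^ 2 ≤
        Real.exp (-(1 / k + (1 / k) ^ 2 / 2)) * Real.exp (-(I / k ^ 2)) := by
      calc 1 - 1 / (k : ℝ) - I / k ^ 2 ≤ (1 - 1 / (k : ℝ)) * (-(I / k ^ 2) + 1) := by
            have : 0 ≤ 1 / (k : ℝ) * (I / k ^ 2) := by positivity
            linarith
        _ ≤ (1 - 1 / (k : ℝ)) * Real.exp (-(I / k ^ 2)) :=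
            mul_le_mul_of_nonneg_left h4 (by linarith)
        _ ≤ _ := mul_le_mul_of_nonneg_right h3 (Real.exp_pos _).le
    calc _ ≤ (1 + 1 / ((n : ℝ) - 1)) *
          (Real.exp (-(1 / k + (1 / k) ^ 2 / 2)) * Real.exp (-(I / k ^ 2))) :=
          mul_le_mul_of_nonneg_left h7 (by linarith)
      _ ≤ _ := mul_le_mul_of_nonneg_right (by linarith) (by positivity)
  have hpow : properBound n m σ ≤
      Real.exp (m * (1 / ((n : ℝ) - 1) - (1 / k + (1 / k) ^ 2 / 2) - I / k ^ 2)) := by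
    rw [Real.exp_nat_mul]
    have h : ((monoPairs σ).card : ℝ) ≤ n.choose 2 := by exact_mod_cast card_monoPairs_le σ
    exact pow_le_pow_left₀ (sub_nonneg.2 (div_le_one_of_le₀ h (Nat.cast_nonneg _))) hbase m
  have hkn : (k : ℝ) ^ n = Real.exp (n * L) := by rw [Real.exp_nat_mul, Real.exp_log hk0]
  refine hpow.trans ?_
  rw [hkn, ← Real.exp_add, ← Real.exp_sub]
  refine Real.exp_le_exp.2 ?_
  have e1 : (m : ℝ) * (1 / ((n : ℝ) - 1)) ≤ d + 1 := by
    rw [mul_one_div, div_le_iff₀ (by linarith)]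
    nlinarith
  have e2 : d * n / 2 * (1 / k + (1 / k) ^ 2 / 2) ≤ m * (1 / k + (1 / (k : ℝ)) ^ 2 / 2) := by
    gcongr
  have e3 : n * (L / (2 * k) * I) ≤ m * (I / (k : ℝ) ^ 2) := by
    calc n * (L / (2 * k) * I) = k * L * n / 2 * (I / (k : ℝ) ^ 2) := by
          field_simp
      _ ≤ d * n / 2 * (I / (k : ℝ) ^ 2) := by gcongr
      _ ≤ _ := by gcongr
  have e4 := mul_le_mul_of_nonneg_left (log_sub_le (by omega) hk4 hd) (by linarith : (0 : ℝ) ≤ n)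
  have e5 : (n : ℝ) * (L - d / 2 * (1 / k + (1 / k) ^ 2 / 2)) =
    n * L - d * n / 2 * (1 / k + (1 / k) ^ 2 / 2) := by ring
  rw [e5] at e4
  linarith [mul_sub (m : ℝ) (1 / ((n : ℝ) - 1) - (1 / k + (1 / k) ^ 2 / 2)) (I / k ^ 2),
    mul_sub (m : ℝ) (1 / ((n : ℝ) - 1)) (1 / k + (1 / k) ^ 2 / 2),
    mul_sub (n : ℝ) (3 / k) (L / (2 * k) * I)]

/-- The relative shortfall of the `j`-th color class outside `R`. -/
noncomputable def shortfall {n k : ℕ} (σ : Fin n → Fin k) (R : Finset (Fin n)) (j : Fin k) : ℝ :=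
  |(k : ℝ) * (univ.filter (σ · = j)).card / n - 1| + k * (R.filter (σ · = j)).card / n

theorem shortfall_nonneg {n k : ℕ} (σ : Fin n → Fin k) (R : Finset (Fin n)) (j : Fin k) :
    0 ≤ shortfall σ R j := by
  unfold shortfall
  positivity

theorem abs_le_of_imbalance_le {n k : ℕ} {σ : Fin n → Fin k} {θ : ℝ} (hθ : 0 ≤ θ)
    (h : imbalance σ ≤ θ ^ 2) (j : Fin k) :
    |(k : ℝ) * (univ.filter (σ · = j)).card / n - 1| ≤ θ := by
  refine abs_le_of_sq_le_sq ?_ hθ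
  exact (single_le_sum (f := fun j => ((k : ℝ) * (univ.filter (σ · = j)).card / n - 1) ^ 2)
    (fun _ _ => sq_nonneg _) (mem_univ j)).trans h

theorem shortfall_le {n k : ℕ} (hn : 0 < n) (hk : 0 < k) {σ : Fin n → Fin k}
    {R : Finset (Fin n)} {θ : ℝ} (hθ : 0 ≤ θ) (h : imbalance σ ≤ θ ^ 2)
    (hR : ∀ j, ((R.filter (σ · = j)).card : ℝ) ≤ 2 * (θ * n / k)) (j : Fin k) :
    shortfall σ R j ≤ 3 * θ := by
  have hn' : (0 : ℝ) < n := by exact_mod_cast hn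
  have hk' : (0 : ℝ) < k := by exact_mod_cast hk
  have h1 := abs_le_of_imbalance_le hθ h j
  have h2 : k * ((R.filter (σ · = j)).card : ℝ) / n ≤ 2 * θ := by
    rw [div_le_iff₀ hn']
    calc k * ((R.filter (σ · = j)).card : ℝ) ≤ k * (2 * (θ * n / k)) := by gcongr; exact hR j
      _ = _ := by field_simp
  unfold shortfall
  linarith

theorem sum_shortfall_le {n k : ℕ} (hn : 0 < n) {σ : Fin n → Fin k} {R : Finset (Fin n)}
    {s : ℝ} (hs : 0 ≤ s) (hks : s ^ 2 = k) (h : imbalance σ ≤ 1) (hR : s * R.card ≤ n) :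
    ∑ j, shortfall σ R j ≤ 2 * s := by
  have hn' : (0 : ℝ) < n := by exact_mod_cast hn
  unfold shortfall
  rw [sum_add_distrib, ← sum_div, ← mul_sum, sum_card_class]
  have h1 : ∑ j, |(k : ℝ) * (univ.filter (σ · = j)).card / n - 1| ≤ s := by
    refine le_of_sq_le_sq ?_ hs
    refine sq_sum_le_card_mul_sum_sq.trans ?_
    simp only [sq_abs, card_univ, Fintype.card_fin]
    rw [hks]
    exact mul_le_of_le_one_right (Nat.cast_nonneg _) h
  have h2 : (k : ℝ) * R.card / n ≤ s := by
    rw [div_le_iff₀ hn', ← hks]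
    nlinarith
  linarith

theorem sum_exp_le_card_add {k : ℕ} {f : Fin k → ℝ} {c Z : ℝ} (hc : 0 ≤ c) (h0 : ∀ j, 0 ≤ f j)
    (hZ : ∀ j, f j ≤ Z) :
    ∑ j, Real.exp (c * f j) ≤ k + c * Real.exp (c * Z) * ∑ j, f j := by
  have h : ∀ j, Real.exp (c * f j) ≤ 1 + c * Real.exp (c * Z) * f j := by
    intro j
    have h1 := Real.add_one_le_exp (-(c * f j))
    have h2 := mul_le_mul_of_nonneg_left h1 (Real.exp_pos (c * f j)).le
    rw [← Real.exp_add, add_neg_cancel, Real.exp_zero] at h2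
    have h3 : c * f j * Real.exp (c * f j) ≤ c * f j * Real.exp (c * Z) := by
      have := hZ j
      have := h0 j
      gcongr
    linarith
  refine (sum_le_sum fun j _ => h j).trans ?_
  rw [sum_add_distrib, ← mul_sum]
  simp

/-- The sets that have at most `2 * t` vertices of each color, and either more than `t` vertices of
some color or more than `r` vertices altogether. -/
noncomputable def midSets {n k : ℕ} (σ : Fin n → Fin k) (t r : ℝ) : Finset (Finset (Fin n)) :=
  univ.filter fun R => (∀ j, ((R.filter (σ · = j)).card : ℝ) ≤ 2 * t) ∧
    ((∃ j, t < ((R.filter (σ · = j)).card : ℝ)) ∨ r < R.card)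

theorem sum_biUnion_le_sum {ι α : Type*} [DecidableEq α] (s : Finset ι) (B : ι → Finset α)
    {f : α → ℝ} (hf : ∀ a, 0 ≤ f a) : ∑ a ∈ s.biUnion B, f a ≤ ∑ i ∈ s, ∑ a ∈ B i, f a := by
  induction s using Finset.induction_on with
  | empty => simp
  | insert i s hi ih =>
    rw [biUnion_insert, sum_insert hi]
    have h := sum_union_inter (s₁ := B i) (s₂ := s.biUnion B) (f := f)
    have h0 : 0 ≤ ∑ a ∈ B i ∩ s.biUnion B, f a := sum_nonneg fun a _ => hf a
    linarith

/-- The expected number, up to lower order terms, of colors available to a vertex of `R` when all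
its neighbours of the new color must lie in `R`. -/
noncomputable def escapeWeight {n k : ℕ} (d : ℝ) (σ : Fin n → Fin k) (R : Finset (Fin n)) : ℝ :=
  ∑ j, Real.exp (-(d / n * (univ.filter (σ · = j) \ R).card))

theorem escapeWeight_nonneg {n k : ℕ} (d : ℝ) (σ : Fin n → Fin k) (R : Finset (Fin n)) :
    0 ≤ escapeWeight d σ R :=
  sum_nonneg fun _ _ => (Real.exp_pos _).le

theorem pos_of_log_pos {k : ℕ} (h : 0 < Real.log k) : 0 < k := by
  rcases Nat.eq_zero_or_pos k with rfl | hk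
  · simp at h
  · exact hk

theorem escapeWeight_le {n k : ℕ} {d : ℝ} (hn : 0 < n) (hk : 0 < k)
    (hd0 : 0 ≤ d) (hd : (2 * Real.log k - 1) * k ≤ d) (hd' : d ≤ 2 * k * Real.log k)
    (σ : Fin n → Fin k) (R : Finset (Fin n)) :
    escapeWeight d σ R ≤
      Real.exp (1 - 2 * Real.log k) * ∑ j, Real.exp (2 * Real.log k * shortfall σ R j) := by
  have hn' : (0 : ℝ) < n := by exact_mod_cast hn
  have hk' : (0 : ℝ) < k := by exact_mod_cast hk
  rw [escapeWeight, mul_sum]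
  refine sum_le_sum fun j _ => ?_
  rw [← Real.exp_add]
  refine Real.exp_le_exp.2 ?_
  have h1 : ((univ.filter (σ · = j)).card : ℝ) =
      (univ.filter (σ · = j) \ R).card + (R.filter (σ · = j)).card := by
    rw [← card_sdiff_add_card_inter (univ.filter (σ · = j)) R, Nat.cast_add]
    congr 3
    ext v
    simp [and_comm]
  have h2 := neg_abs_le ((k : ℝ) * (univ.filter (σ · = j)).card / n - 1)
  have h0 := shortfall_nonneg σ R j
  have h3 : 1 - shortfall σ R j ≤ k * (univ.filter (σ · = j) \ R).card / n := by
    have : (k : ℝ) * (univ.filter (σ · = j)).card / n =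
      k * (univ.filter (σ · = j) \ R).card / n + k * (R.filter (σ · = j)).card / n := by
      rw [h1]
      ring
    unfold shortfall
    linarith
  have h4 : d / k * (1 - shortfall σ R j) ≤ d / n * (univ.filter (σ · = j) \ R).card := by
    calc d / k * (1 - shortfall σ R j) ≤ d / k * (k * (univ.filter (σ · = j) \ R).card / n) := by
          gcongr
      _ = _ := by field_simp
  have h5 : d / k ≤ 2 * Real.log k := by
    rw [div_le_iff₀ hk']
    linarith
  have h6 : 2 * Real.log k - 1 ≤ d / k := by rwa [le_div_iff₀ hk']
  nlinarith

theorem sum_large_le {n k : ℕ} {d : ℝ} (hn : 0 < n) (hL : 10000 ≤ Real.log k)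
    (hd : (2 * Real.log k - 1) * k ≤ d) (hd' : d ≤ 2 * k * Real.log k)
    {σ : Fin n → Fin k} (hσ : imbalance σ ≤ (1 / 32) ^ 2)
    (A : Finset (Finset (Fin n)))
    (hA : ∀ R ∈ A, (∀ j, ((R.filter (σ · = j)).card : ℝ) ≤ 2 * (1 / 32 * n / k)) ∧
      Real.exp (-(Real.log k / 2)) * n < R.card) :
    ∑ R ∈ A, escapeWeight d σ R ^ R.card ≤ Real.exp (-(4 * n / k)) := by
  have hn' : (0 : ℝ) < n := by exact_mod_cast hn
  have hk : 0 < k := pos_of_log_pos (by linarith)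
  have hk' : (0 : ℝ) < k := by exact_mod_cast hk
  have hkL : (k : ℝ) = Real.exp (Real.log k) := (Real.exp_log hk').symm
  have he : Real.exp 1 ≤ 3 := by linarith [Real.exp_one_lt_d9]
  have hd0 : 0 ≤ d := le_trans (mul_nonneg (by linarith) hk'.le) hd
  set L := Real.log k with hLdef
  have hw : ∀ R ∈ A, escapeWeight d σ R ≤ Real.exp (1 - L + 6 / 32 * L) := by
    intro R hR
    have hR' := (hA R hR).1
    refine (escapeWeight_le hn hk hd0 hd hd' σ R).trans ?_
    have h1 : ∀ j, Real.exp (2 * L * shortfall σ R j) ≤ Real.exp (6 / 32 * L) := by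
      intro j
      have := shortfall_le hn hk (by norm_num) hσ hR' j
      refine Real.exp_le_exp.2 ?_
      nlinarith
    have h2 : ∑ j, Real.exp (2 * L * shortfall σ R j) ≤ k * Real.exp (6 / 32 * L) := by
      refine (sum_le_sum fun j _ => h1 j).trans ?_
      simp
    refine (mul_le_mul_of_nonneg_left h2 (Real.exp_pos _).le).trans ?_
    rw [← hLdef, hkL, ← Real.exp_add, ← Real.exp_add]
    refine Real.exp_le_exp.2 ?_
    linarith
  refine (sum_le_sum fun R hR => pow_le_pow_left₀ (escapeWeight_nonneg d σ R) (hw R hR) _).trans ?_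
  refine (sum_pow_card_le A univ (T := Real.exp (L / 4)) (r := Real.exp (-(L / 2)) * n)
    (Real.exp_pos _).le
    (Real.one_le_exp (by linarith)) fun R hR => ?_).trans ?_
  · rw [inter_univ]
    exact (hA R hR).2.le
  refine Real.exp_le_exp.2 ?_
  rw [card_univ, Fintype.card_fin, Real.log_exp]
  have h1 : Real.exp (1 - L + 6 / 32 * L) ≤ 3 * Real.exp (-(L / 2)) := by
    refine le_trans ?_ (mul_le_mul_of_nonneg_right he (Real.exp_pos _).le)
    rw [← Real.exp_add]
    refine Real.exp_le_exp.2 ?_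
    linarith
  have h2 : Real.exp (1 - L + 6 / 32 * L) * Real.exp (L / 4) ≤ 3 * Real.exp (-(L / 2)) := by
    refine le_trans ?_ (mul_le_mul_of_nonneg_right he (Real.exp_pos _).le)
    rw [← Real.exp_add, ← Real.exp_add]
    refine Real.exp_le_exp.2 ?_
    linarith
  have h3 : 1 / (k : ℝ) ≤ Real.exp (-(L / 2)) := by
    rw [one_div, hkL, ← Real.exp_neg]
    refine Real.exp_le_exp.2 ?_
    linarith
  have h4 : 4 * n / (k : ℝ) ≤ 4 * (Real.exp (-(L / 2)) * n) := by
    calc 4 * n / (k : ℝ) = 4 * (1 / k * n) := by ring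
      _ ≤ _ := by gcongr
  have h5 := mul_le_mul_of_nonneg_right h1 hn'.le
  have h6 := mul_le_mul_of_nonneg_right h2 hn'.le
  have h7 : 0 ≤ Real.exp (-(L / 2)) * n := by positivity
  nlinarith

theorem sum_class_le {n k : ℕ} {d : ℝ} (hn : 0 < n) (hL : 10000 ≤ Real.log k)
    (hd : (2 * Real.log k - 1) * k ≤ d) (hd' : d ≤ 2 * k * Real.log k)
    {σ : Fin n → Fin k} (hσ : imbalance σ ≤ (1 / 32) ^ 2)
    (j : Fin k) (B : Finset (Finset (Fin n)))
    (hB : ∀ R ∈ B, (∀ j, ((R.filter (σ · = j)).card : ℝ) ≤ 2 * (1 / 32 * n / k)) ∧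
      (R.card : ℝ) ≤ Real.exp (-(Real.log k / 2)) * n ∧
      1 / 32 * n / k < ((R.filter (σ · = j)).card : ℝ)) :
    ∑ R ∈ B, escapeWeight d σ R ^ R.card ≤ Real.exp (-(4 * n / k)) := by
  have hn' : (0 : ℝ) < n := by exact_mod_cast hn
  have hk : 0 < k := pos_of_log_pos (by linarith)
  have hk' : (0 : ℝ) < k := by exact_mod_cast hk
  have hkL : (k : ℝ) = Real.exp (Real.log k) := (Real.exp_log hk').symm
  have he : Real.exp 1 ≤ 3 := by linarith [Real.exp_one_lt_d9]
  have hd0 : 0 ≤ d := le_trans (mul_nonneg (by linarith) hk'.le) hd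
  set L := Real.log k with hLdef
  have hw : ∀ R ∈ B, escapeWeight d σ R ≤ 2 * Real.exp (1 - L) := by
    intro R hR
    obtain ⟨hR1, hR2, -⟩ := hB R hR
    refine (escapeWeight_le hn hk hd0 hd hd' σ R).trans ?_
    have h1 := sum_exp_le_card_add (c := 2 * L) (f := shortfall σ R) (by linarith)
      (shortfall_nonneg σ R) (shortfall_le hn hk (by norm_num) hσ hR1)
    have h2 := sum_shortfall_le hn (R := R) (s := Real.exp (L / 2)) (Real.exp_pos _).le
      (by rw [← Real.exp_nat_mul, hkL]; congr 1; push_cast; ring)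
      (hσ.trans (by norm_num)) (by
        calc Real.exp (L / 2) * R.card ≤ Real.exp (L / 2) * (Real.exp (-(L / 2)) * n) := by gcongr
          _ = n := by rw [← mul_assoc, ← Real.exp_add]; simp)
    have h3 : 4 * L ≤ Real.exp (5 / 16 * L) := by
      have := Real.quadratic_le_exp_of_nonneg (x := 5 / 16 * L) (by linarith)
      nlinarith
    have h4 : 2 * L * Real.exp (2 * L * (3 * (1 / 32))) * ∑ j, shortfall σ R j ≤ k := by
      calc _ ≤ 2 * L * Real.exp (2 * L * (3 * (1 / 32))) * (2 * Real.exp (L / 2)) := by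
            gcongr
        _ = 4 * L * Real.exp (11 / 16 * L) := by
            rw [show 11 / 16 * L = 2 * L * (3 * (1 / 32)) + L / 2 by ring, Real.exp_add]
            ring
        _ ≤ Real.exp (5 / 16 * L) * Real.exp (11 / 16 * L) := by gcongr
        _ = k := by
            rw [hkL, ← Real.exp_add]
            congr 1
            ring
    calc _ ≤ Real.exp (1 - 2 * L) * (2 * k) :=
          mul_le_mul_of_nonneg_left (by linarith) (Real.exp_pos _).le
      _ = _ := by
          rw [hkL, mul_left_comm, ← Real.exp_add]
          congr 2
          ring
  refine (sum_le_sum fun R hR => pow_le_pow_left₀ (escapeWeight_nonneg d σ R) (hw R hR) _).trans ?_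
  refine (sum_pow_card_le (B) (univ.filter (σ · = j)) (T := k) (r := 1 / 32 * n / k) (by positivity)
    (by exact_mod_cast hk) fun R hR => ?_).trans ?_
  · have hcap : R ∩ univ.filter (σ · = j) = R.filter (σ · = j) := by
      ext v
      simp
    rw [hcap]
    exact (hB R hR).2.2.le
  refine Real.exp_le_exp.2 ?_
  have h1 : Real.exp (1 - L) = Real.exp 1 / k := by rw [Real.exp_sub, ← hkL]
  have h2 : ((univ.filter (σ · = j)).card : ℝ) ≤ 2 * (n / k) := by
    have := (abs_le.1 (abs_le_of_imbalance_le (by norm_num) hσ j)).2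
    have h3 : (k : ℝ) * (univ.filter (σ · = j)).card / n ≤ 2 := by linarith
    rw [div_le_iff₀ hn'] at h3
    rw [mul_div_assoc', le_div_iff₀ hk']
    linarith
  have h3 : 2 * Real.exp (1 - L) * k = 2 * Real.exp 1 := by
    rw [h1, mul_assoc, div_mul_cancel₀ _ hk'.ne']
  have h4 : 2 * Real.exp (1 - L) * n = 2 * Real.exp 1 * (n / k) := by
    rw [h1]
    ring
  have h5 : 0 ≤ (n : ℝ) / k := by positivity
  have h6 : 1 / 32 * (n : ℝ) / k = 1 / 32 * (n / k) := by ring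
  have h7 : 4 * (n : ℝ) / k = 4 * (n / k) := by ring
  rw [h3, h4, h6, h7]
  have h8 : 2 * Real.exp 1 * ((univ.filter (σ · = j)).card : ℝ) ≤ 6 * (2 * (n / k)) := by
    exact mul_le_mul (by linarith) h2 (Nat.cast_nonneg _) (by norm_num)
  have h9 := mul_le_mul_of_nonneg_right he h5
  have h10 := mul_le_mul_of_nonneg_left hL h5
  linarith

theorem sum_midSets_le {n k : ℕ} {d : ℝ} (hn : 0 < n) (hL : 10000 ≤ Real.log k)
    (hd : (2 * Real.log k - 1) * k ≤ d) (hd' : d ≤ 2 * k * Real.log k)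
    {σ : Fin n → Fin k} (hσ : imbalance σ ≤ (1 / 32) ^ 2) :
    ∑ R ∈ midSets σ (1 / 32 * n / k) (Real.exp (-(Real.log k / 2)) * n),
      escapeWeight d σ R ^ R.card ≤ (k + 1) * Real.exp (-(4 * n / k)) := by
  set t : ℝ := 1 / 32 * n / k with ht
  set r : ℝ := Real.exp (-(Real.log k / 2)) * n with hr
  obtain ⟨A, hA⟩ : ∃ A : Finset (Finset (Fin n)), ∀ R, R ∈ A ↔
      (∀ j, ((R.filter (σ · = j)).card : ℝ) ≤ 2 * t) ∧ r < R.card :=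
    ⟨univ.filter fun R => (∀ j, ((R.filter (σ · = j)).card : ℝ) ≤ 2 * t) ∧ r < R.card,
      fun R => by simp only [mem_filter, mem_univ, true_and]⟩
  obtain ⟨B, hB⟩ : ∃ B : Fin k → Finset (Finset (Fin n)), ∀ j R, R ∈ B j ↔
      (∀ j, ((R.filter (σ · = j)).card : ℝ) ≤ 2 * t) ∧ (R.card : ℝ) ≤ r ∧
        t < ((R.filter (σ · = j)).card : ℝ) :=
    ⟨fun j => univ.filter fun R => (∀ j, ((R.filter (σ · = j)).card : ℝ) ≤ 2 * t) ∧
        (R.card : ℝ) ≤ r ∧ t < ((R.filter (σ · = j)).card : ℝ),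
      fun j R => by simp only [mem_filter, mem_univ, true_and]⟩
  have hsub : midSets σ t r ⊆ A ∪ univ.biUnion B := by
    intro R hR
    simp only [midSets, mem_filter, mem_union, mem_biUnion, mem_univ, true_and, hA, hB] at hR ⊢
    rcases le_or_gt (R.card : ℝ) r with h | h
    · obtain ⟨j, hj⟩ := hR.2.resolve_right (not_lt.2 h)
      exact Or.inr ⟨j, hR.1, h, hj⟩
    · exact Or.inl ⟨hR.1, h⟩
  have hAsum := sum_large_le hn hL hd hd' hσ A fun R hR => (hA R).1 hR
  have hBsum := fun j => sum_class_le hn hL hd hd' hσ j (B j) fun R hR => (hB j R).1 hR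
  have hw : ∀ R, 0 ≤ escapeWeight d σ R ^ R.card :=
    fun R => pow_nonneg (escapeWeight_nonneg d σ R) _
  have h1 : ∑ R ∈ midSets σ t r, escapeWeight d σ R ^ R.card ≤
      ∑ R ∈ A ∪ univ.biUnion B, escapeWeight d σ R ^ R.card :=
    sum_le_sum_of_subset_of_nonneg hsub fun R _ _ => hw R
  have h2 : ∑ R ∈ A ∪ univ.biUnion B, escapeWeight d σ R ^ R.card ≤
      ∑ R ∈ A, escapeWeight d σ R ^ R.card +
        ∑ R ∈ univ.biUnion B, escapeWeight d σ R ^ R.card := by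
    rw [← sum_union_inter]
    exact le_add_of_nonneg_right (sum_nonneg fun R _ => hw R)
  have h3 := sum_biUnion_le_sum univ B hw
  have h4 : ∑ j, ∑ R ∈ B j, escapeWeight d σ R ^ R.card ≤ k * Real.exp (-(4 * n / k)) := by
    refine (sum_le_sum fun j _ => hBsum j).trans_eq ?_
    simp only [sum_const, card_univ, Fintype.card_fin, nsmul_eq_mul]
  refine h1.trans (h2.trans ?_)
  rw [add_one_mul, add_comm]
  exact add_le_add (h3.trans h4) hAsum

theorem log_add_four_le {k : ℕ} (hL : 10000 ≤ Real.log k) : Real.log k + 4 ≤ k := by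
  have hk : (0 : ℝ) < k := Nat.cast_pos.2 (pos_of_log_pos (by linarith))
  have h := Real.quadratic_le_exp_of_nonneg (x := Real.log k) (by linarith)
  rw [Real.exp_log hk] at h
  nlinarith

/-- The expected number of graphs for which `σ` is a proper coloring without a large frozen set. -/
theorem card_not_frozen_le {n m k : ℕ} {d δ : ℝ} (hn : 2 ≤ n) (hL : 10000 ≤ Real.log k)
    (hd : 2 * k * Real.log k - Real.log k - 4 ≤ d) (hd' : d ≤ 2 * k * Real.log k)
    (hm : d * n / 2 ≤ m) (hm' : m ≤ d * n / 2 + 1) (hδ : δ * n ≤ 1 / 32 * n / k)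
    (σ : Fin n → Fin k) :
    (((graphs n m).filter fun E => IsColoring E σ ∧ ¬ ∃ F : Finset (Fin n),
      (n : ℝ) - Real.exp (-(Real.log k / 2)) * n ≤ F.card ∧ Frozen E σ F δ).card : ℝ) ≤
      (graphs n m).card * ((k + 1) * Real.exp (d + 1) * Real.exp (-(n / k)) / k ^ n) := by
  have hk : 0 < k := pos_of_log_pos (by linarith)
  have hk0 : (0 : ℝ) < k := Nat.cast_pos.2 hk
  have hn0 : (2 : ℝ) ≤ n := by exact_mod_cast hn
  have hnk : (0 : ℝ) ≤ n / k := by positivity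
  have hk4 := log_add_four_le hL
  have hk2 : 2 ≤ k := by
    have : (2 : ℝ) ≤ k := by linarith
    exact_mod_cast this
  have hd1 : (2 * Real.log k - 1) * k ≤ d := by linarith
  have hd2 : k * Real.log k ≤ d := by nlinarith
  have hd0 : 0 ≤ d := le_trans (by nlinarith) hd2
  have hchoose : 0 < n.choose 2 := Nat.choose_pos hn
  have hP := properBound_le hn hk2 hk4 hd hd2 hm hm' σ
  have hG : (0 : ℝ) ≤ (graphs n m).card := Nat.cast_nonneg _
  rcases lt_or_ge ((1 / 32) ^ 2) (imbalance σ) with hσ | hσ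
  · have h1 : (((graphs n m).filter fun E => IsColoring E σ ∧ ¬ ∃ F : Finset (Fin n),
        (n : ℝ) - Real.exp (-(Real.log k / 2)) * n ≤ F.card ∧ Frozen E σ F δ).card : ℝ) ≤
        ((graphs n m).filter fun E => IsColoring E σ).card :=
      Nat.cast_le.2 (card_le_card (monotone_filter_right _ fun E _ hE => hE.1))
    refine h1.trans ((card_isColoring_le hchoose σ).trans
      (mul_le_mul_of_nonneg_left (hP.trans ?_) hG))
    have h2 : (n : ℝ) * (3 / k - Real.log k / (2 * k) * imbalance σ) ≤ -(n / k) := by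
      have h3 : (n : ℝ) * (3 / k - Real.log k / (2 * k) * imbalance σ) =
          n / k * (3 - Real.log k * imbalance σ / 2) := by
        field_simp
      have h4 : 8 ≤ Real.log k * imbalance σ := by nlinarith
      rw [h3]
      nlinarith
    refine div_le_div_of_nonneg_right ?_ (by positivity)
    refine mul_le_mul ?_ (Real.exp_le_exp.2 h2) (Real.exp_pos _).le (by positivity)
    exact le_mul_of_one_le_left (Real.exp_pos _).le (by linarith)
  · set S := midSets σ (1 / 32 * n / k) (Real.exp (-(Real.log k / 2)) * n) with hS
    have ha : d / n ≤ m / n.choose 2 := by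
      rw [div_le_div_iff₀ (by linarith) (Nat.cast_pos.2 hchoose), Nat.cast_choose_two]
      nlinarith [mul_le_mul_of_nonneg_right hm (by linarith : (0 : ℝ) ≤ n),
        mul_nonneg hd0 (by linarith : (0 : ℝ) ≤ n)]
    have hsub : ((graphs n m).filter fun E => IsColoring E σ ∧ ¬ ∃ F : Finset (Fin n),
        (n : ℝ) - Real.exp (-(Real.log k / 2)) * n ≤ F.card ∧ Frozen E σ F δ) ⊆
        S.biUnion fun R => (graphs n m).filter fun E => IsColoring E σ ∧ Closed E σ R := by
      intro E hE
      obtain ⟨hE, hcol, hF⟩ := mem_filter.1 hE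
      by_contra hR
      refine hF (exists_frozen (by positivity) hδ fun R hcl hR2 => ?_)
      by_contra hbad
      refine hR (mem_biUnion.2 ⟨R, ?_, mem_filter.2 ⟨hE, hcol, hcl⟩⟩)
      simp only [hS, midSets, mem_filter, mem_univ, true_and]
      refine ⟨hR2, ?_⟩
      simpa only [not_and_or, not_forall, not_le] using hbad
    have h1 : ((S.biUnion fun R =>
        (graphs n m).filter fun E => IsColoring E σ ∧ Closed E σ R).card : ℝ) ≤
        ∑ R ∈ S, (graphs n m).card * properBound n m σ * escapeWeight d σ R ^ R.card := by
      refine (Nat.cast_le.2 card_biUnion_le).trans ?_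
      rw [Nat.cast_sum]
      exact sum_le_sum fun R _ => card_closed_le hchoose σ R ha
    refine (Nat.cast_le.2 (card_le_card hsub)).trans (h1.trans ?_)
    rw [← mul_sum, mul_assoc]
    refine mul_le_mul_of_nonneg_left ?_ hG
    have h2 : properBound n m σ ≤ Real.exp (d + 1) * Real.exp (3 * n / k) / k ^ n := by
      refine hP.trans (div_le_div_of_nonneg_right (mul_le_mul_of_nonneg_left
        (Real.exp_le_exp.2 ?_) (Real.exp_pos _).le) (by positivity))
      have h3 : 0 ≤ n * (Real.log k / (2 * k) * imbalance σ) :=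
        mul_nonneg (by linarith)
          (mul_nonneg (div_nonneg (by linarith) (by linarith)) (imbalance_nonneg σ))
      have h4 : 3 * (n : ℝ) / k = n * (3 / k) := by ring
      rw [h4]
      linarith
    have h3 := sum_midSets_le (by omega) hL hd1 hd' hσ
    refine (mul_le_mul h2 h3 (sum_nonneg fun R _ => pow_nonneg (escapeWeight_nonneg d σ R) _)
      (by positivity)).trans_eq ?_
    have h5 : Real.exp (-((n : ℝ) / k)) = Real.exp (3 * n / k) * Real.exp (-(4 * n / k)) := by
      rw [← Real.exp_add]
      congr 1
      ring
    rw [h5]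
    ring

theorem card_exists_not_frozen_le {n m k : ℕ} {d δ : ℝ} (hn : 2 ≤ n) (hL : 10000 ≤ Real.log k)
    (hd : 2 * k * Real.log k - Real.log k - 4 ≤ d) (hd' : d ≤ 2 * k * Real.log k)
    (hm : d * n / 2 ≤ m) (hm' : m ≤ d * n / 2 + 1) (hδ : δ * n ≤ 1 / 32 * n / k) :
    (((graphs n m).filter fun E => ¬ ∀ σ : Fin n → Fin k, IsColoring E σ →
      ∃ F : Finset (Fin n), (n : ℝ) - Real.exp (-(Real.log k / 2)) * n ≤ F.card ∧
        Frozen E σ F δ).card : ℝ) ≤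
      (graphs n m).card * ((k + 1) * Real.exp (d + 1) * Real.exp (-(n / k))) := by
  have hk : (k : ℝ) ≠ 0 := Nat.cast_ne_zero.2 (pos_of_log_pos (by linarith)).ne'
  have hsub : ((graphs n m).filter fun E => ¬ ∀ σ : Fin n → Fin k, IsColoring E σ →
      ∃ F : Finset (Fin n), (n : ℝ) - Real.exp (-(Real.log k / 2)) * n ≤ F.card ∧
        Frozen E σ F δ) ⊆
      (univ : Finset (Fin n → Fin k)).biUnion fun σ =>
        (graphs n m).filter fun E => IsColoring E σ ∧ ¬ ∃ F : Finset (Fin n),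
          (n : ℝ) - Real.exp (-(Real.log k / 2)) * n ≤ F.card ∧ Frozen E σ F δ := by
    intro E hE
    obtain ⟨hE, h⟩ := mem_filter.1 hE
    obtain ⟨σ, h⟩ := not_forall.1 h
    exact mem_biUnion.2 ⟨σ, mem_univ _, mem_filter.2 ⟨hE, Classical.not_imp.1 h⟩⟩
  refine (Nat.cast_le.2 ((card_le_card hsub).trans card_biUnion_le)).trans ?_
  rw [Nat.cast_sum]
  refine (sum_le_sum fun σ _ => card_not_frozen_le hn hL hd hd' hm hm' hδ σ).trans_eq ?_
  rw [sum_const, card_univ, Fintype.card_fun, Fintype.card_fin, Fintype.card_fin, nsmul_eq_mul]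
  push_cast
  field_simp

theorem le_prob_forall_frozen {n m k : ℕ} {d δ : ℝ} (hn : 2 ≤ n) (hL : 10000 ≤ Real.log k)
    (hd : 2 * k * Real.log k - Real.log k - 4 ≤ d) (hd' : d ≤ 2 * k * Real.log k)
    (hm : d * n / 2 ≤ m) (hm' : m ≤ d * n / 2 + 1) (hmn : m ≤ n.choose 2)
    (hδ : δ * n ≤ 1 / 32 * n / k) :
    1 - (k + 1) * Real.exp (d + 1) * Real.exp (-(n / k)) ≤
      prob fun G : GraphSpace n m => ∀ σ : Fin n → Fin k, IsColoring G.1 σ →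
        ∃ F : Finset (Fin n), (1 - Real.exp (-(Real.log k / 2))) * n ≤ F.card ∧
          Frozen G.1 σ F δ := by
  have hG : (0 : ℝ) < (graphs n m).card := by
    rw [graphs, card_powersetCard, card_nonDiag]
    exact Nat.cast_pos.2 (Nat.choose_pos hmn)
  have h : ∀ p : Finset (Sym2 (Fin n)) → Prop, ∀ x : ℝ,
      (((graphs n m).filter fun E => ¬ p E).card : ℝ) ≤ (graphs n m).card * x →
      1 - x ≤ ((graphs n m).filter p).card / (graphs n m).card := by
    intro p x hx
    have h1 : (((graphs n m).filter p).card : ℝ) + ((graphs n m).filter fun E => ¬ p E).card =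
        (graphs n m).card := by
      exact_mod_cast card_filter_add_card_filter_not (s := graphs n m) p
    rw [le_div_iff₀ hG]
    linarith
  simp only [one_sub_mul]
  rw [prob_eq n m fun E => ∀ σ : Fin n → Fin k, IsColoring E σ →
    ∃ F : Finset (Fin n), (n : ℝ) - Real.exp (-(Real.log k / 2)) * n ≤ F.card ∧ Frozen E σ F δ]
  refine h _ _ ?_
  convert card_exists_not_frozen_le hn hL hd hd' hm hm' hδ

theorem prob_le_one {Ω : Type*} [Finite Ω] (p : Ω → Prop) : prob p ≤ 1 :=
  div_le_one_of_le₀ (Nat.cast_le.2 (Nat.card_le_card_of_injective _ Subtype.val_injective))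
    (Nat.cast_nonneg _)

theorem finite_graphSpace (n m : ℕ) : Finite (GraphSpace n m) :=
  Subtype.finite

end RandomGraph

theorem statement1 :
    ∃ (k₀ : ℕ) (ε η : ℕ → ℝ),
      (∀ k, 0 < ε k) ∧ (∀ k, 0 < η k) ∧
      Tendsto ε atTop (nhds 0) ∧ Tendsto η atTop (nhds 0) ∧
      ∀ k : ℕ, k₀ ≤ k → ∀ d : ℝ,
        2 * k * Real.log k - Real.log k - 4 + ε k ≤ d →
        d ≤ 2 * k * Real.log k →
        Tendsto (fun n : ℕ =>
            prob (fun G : GraphSpace n ⌈d * n / 2⌉₊ =>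
              ∀ σ : Fin n → Fin k, IsColoring G.1 σ →
                ∃ F : Finset (Fin n),
                  (1 - η k) * n ≤ (F.card : ℝ) ∧
                  Frozen G.1 σ F (1 / (k * Real.log k))))
          atTop (nhds 1) := by
  refine ⟨⌈Real.exp 10000⌉₊, fun k => 1 / (k + 1), fun k => Real.exp (-(Real.log k / 2)),
    fun k => by positivity, fun k => Real.exp_pos _, tendsto_one_div_add_atTop_nhds_zero_nat,
    Real.tendsto_exp_neg_atTop_nhds_zero.comp ((Real.tendsto_log_atTop.comp
      tendsto_natCast_atTop_atTop).atTop_div_const two_pos), fun k hk d hd hd' => ?_⟩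
  have hL : 10000 ≤ Real.log k :=
    (Real.le_log_iff_exp_le (lt_of_lt_of_le (Real.exp_pos _) (Nat.ceil_le.1 hk))).2
      (Nat.ceil_le.1 hk)
  have hk0 : (0 : ℝ) < k := Nat.cast_pos.2 (pos_of_log_pos (by linarith))
  have hε : (0 : ℝ) < 1 / (k + 1) := by positivity
  have hk4 := log_add_four_le hL
  have hd0 : 0 ≤ d := by nlinarith
  have hlim : Tendsto (fun n : ℕ => 1 - (k + 1) * Real.exp (d + 1) * Real.exp (-((n : ℝ) / k)))
      atTop (nhds 1) := by
    have h := ((Real.tendsto_exp_neg_atTop_nhds_zero.comp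
      (tendsto_natCast_atTop_atTop.atTop_div_const hk0)).const_mul
        ((k + 1) * Real.exp (d + 1))).const_sub 1
    simpa only [mul_zero, sub_zero, Function.comp_apply] using h
  refine tendsto_of_tendsto_of_tendsto_of_le_of_le' hlim tendsto_const_nhds ?_
    (Eventually.of_forall fun n => ?_)
  · filter_upwards [eventually_ge_atTop (⌈d⌉₊ + 4)] with n hn
    have hn' : d + 4 ≤ n := by
      have h1 : ((⌈d⌉₊ + 4 : ℕ) : ℝ) ≤ n := Nat.cast_le.2 hn
      push_cast at h1
      linarith [Nat.le_ceil d]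
    have hm' : (⌈d * n / 2⌉₊ : ℝ) ≤ d * n / 2 + 1 := (Nat.ceil_lt_add_one (by positivity)).le
    refine le_prob_forall_frozen (by omega) hL (by linarith) hd' (Nat.le_ceil _) hm' ?_ ?_
    · rw [← Nat.cast_le (α := ℝ), Nat.cast_choose_two]
      nlinarith
    · have h1 : 1 / (k * Real.log k) * n = 1 / Real.log k * (n / k) := by
        field_simp
      have h2 : 1 / 32 * (n : ℝ) / k = 1 / 32 * (n / k) := by ring
      rw [h1, h2]
      exact mul_le_mul_of_nonneg_right
        (one_div_le_one_div_of_le (by norm_num) (by linarith)) (by positivity)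
  · have := finite_graphSpace n ⌈d * n / 2⌉₊
    exact prob_le_one _
end
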